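/- arXiv:1912.10349 — 4 statements merged into one kernel-verified Lean document; each statement's English description precedes it below -/
import Mathlib

section
/- Every 3-regular connected graph without cut edges has a perfect matching (Petersen's Theorem). -/
open SimpleGraph

variable {V : Type*}

/-- Two edges are adjacent: distinct and sharing an endpoint. -/
def EdgesAdj (e₁ e₂ : Sym2 V) : Prop := e₁ ≠ e₂ ∧ ∃ v, v ∈ e₁ ∧ v ∈ e₂

/-- `F` is an edge-cut of `G` separating `x` and `y`. -/
def IsSepCut (G : SimpleGraph V) (F : Set (Sym2 V)) (x y : V) : Prop :=
  F ⊆ G.edgeSet ∧ ¬ (G.deleteEdges F).Reachable x y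

/-- `F` is a proper edge-cut (w.r.t. edge-coloring `c`) separating `x` and `y`. -/
def IsProperSepCut (G : SimpleGraph V) (c : Sym2 V → ℕ) (F : Set (Sym2 V)) (x y : V) : Prop :=
  IsSepCut G F x y ∧ ∀ e₁ ∈ F, ∀ e₂ ∈ F, EdgesAdj e₁ e₂ → c e₁ ≠ c e₂

/-- `F` is a rainbow edge-cut separating `x` and `y`. -/
def IsRainbowSepCut (G : SimpleGraph V) (c : Sym2 V → ℕ) (F : Set (Sym2 V)) (x y : V) : Prop :=
  IsSepCut G F x y ∧ Set.InjOn c F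

/-- `F` is a matching cut separating `x` and `y`. -/
def IsMatchingSepCut (G : SimpleGraph V) (F : Set (Sym2 V)) (x y : V) : Prop :=
  IsSepCut G F x y ∧ ∀ e₁ ∈ F, ∀ e₂ ∈ F, ¬ EdgesAdj e₁ e₂

/-- The proper disconnection number. -/
noncomputable def pd (G : SimpleGraph V) : ℕ :=
  sInf {k | ∃ c : Sym2 V → ℕ, (∀ e ∈ G.edgeSet, c e < k) ∧
    ∀ x y : V, x ≠ y → ∃ F, IsProperSepCut G c F x y}

/-- The rainbow disconnection number. -/
noncomputable def rd (G : SimpleGraph V) : ℕ :=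
  sInf {k | ∃ c : Sym2 V → ℕ, (∀ e ∈ G.edgeSet, c e < k) ∧
    ∀ x y : V, x ≠ y → ∃ F, IsRainbowSepCut G c F x y}

/-- The chromatic index. -/
noncomputable def chromIndex (G : SimpleGraph V) : ℕ :=
  sInf {k | ∃ c : Sym2 V → ℕ, (∀ e ∈ G.edgeSet, c e < k) ∧
    ∀ e₁ ∈ G.edgeSet, ∀ e₂ ∈ G.edgeSet, EdgesAdj e₁ e₂ → c e₁ ≠ c e₂}

/-- The boundary darts of a vertex set, as ordered pairs. -/
noncomputable def petersenBd {V : Type*} [Fintype V] (G : SimpleGraph V) (S : Set V) :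
    Finset (V × V) := by
  classical
  exact Finset.univ.filter (fun p => p.1 ∈ S ∧ p.2 ∉ S ∧ G.Adj p.1 p.2)

theorem mem_petersenBd {V : Type*} [Fintype V] (G : SimpleGraph V) (S : Set V) (p : V × V) :
    p ∈ petersenBd G S ↔ p.1 ∈ S ∧ p.2 ∉ S ∧ G.Adj p.1 p.2 := by
  classical
  simp [petersenBd]

/-- Counting the darts starting in `S` of a cubic graph. -/
theorem petersen_count {V : Type*} [Fintype V] [DecidableEq V] (G : SimpleGraph V)
    [DecidableRel G.Adj]
    (hreg : G.IsRegularOfDegree 3) (S : Set V) [DecidablePred (· ∈ S)] :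
    (Finset.univ.filter (fun p : V × V => p.1 ∈ S ∧ G.Adj p.1 p.2)).card = S.ncard * 3 := by
  rw [Set.ncard_eq_toFinset_card' S]
  rw [Finset.card_eq_sum_card_fiberwise (f := Prod.fst) (t := S.toFinset)]
  · rw [Finset.sum_const_nat]
    intro a ha
    rw [← hreg a, ← card_neighborFinset_eq_degree]
    refine Finset.card_bij' (fun p _ => p.2) (fun b _ => (a, b)) ?_ ?_ ?_ ?_
    · rintro ⟨x, y⟩ h
      simp at h ⊢
      grind
    · intro y h
      simp at h ha ⊢
      grind
    · rintro ⟨x, y⟩ h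
      simp at h ⊢
      grind
    · simp
  · rintro ⟨x, y⟩ h
    simp at h ⊢
    exact h.1

theorem petersenBd_odd {V : Type*} [Fintype V] (G : SimpleGraph V) [DecidableRel G.Adj]
    (hreg : G.IsRegularOfDegree 3) (S : Set V) (hS : Odd S.ncard) :
    Odd (petersenBd G S).card := by
  classical
  -- all darts starting in `S`
  let A : Finset (V × V) := Finset.univ.filter (fun p => p.1 ∈ S ∧ G.Adj p.1 p.2)
  let I : Finset (V × V) := Finset.univ.filter (fun p => p.1 ∈ S ∧ p.2 ∈ S ∧ G.Adj p.1 p.2)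
  have hA : A.card = S.ncard * 3 := petersen_count G hreg S
  have hI : Even I.card := by
    let K : SimpleGraph V := ⟨fun a b => a ∈ S ∧ b ∈ S ∧ G.Adj a b,
      ⟨fun a b h => ⟨h.2.1, h.1, h.2.2.symm⟩⟩, ⟨fun a h => h.2.2.ne rfl⟩⟩
    have hK : I.card = Fintype.card K.Dart := by
      rw [← Finset.card_univ]
      symm
      apply Finset.card_bij (fun d _ => d.toProd)
      · intro d _
        have hd : d.fst ∈ S ∧ d.snd ∈ S ∧ G.Adj d.fst d.snd := d.adj
        simp only [I, Finset.mem_filter, Finset.mem_univ, true_and]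
        exact hd
      · intro d _ d' _ h
        exact Dart.ext _ _ h
      · intro p hp
        simp only [I, Finset.mem_filter, Finset.mem_univ, true_and] at hp
        exact ⟨⟨p, hp⟩, Finset.mem_univ _, rfl⟩
    rw [hK, dart_card_eq_twice_card_edges]
    exact even_two_mul _
  have hsum : A.card = I.card + (petersenBd G S).card := by
    rw [← Finset.card_union_of_disjoint]
    · congr 1
      ext p
      simp only [A, I, Finset.mem_union, mem_petersenBd, Finset.mem_filter, Finset.mem_univ,
        true_and]
      tauto
    · rw [Finset.disjoint_left]
      intro p hp hq
      simp only [I, mem_petersenBd, Finset.mem_filter, Finset.mem_univ, true_and] at hp hq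
      tauto
  obtain ⟨k, hk⟩ := hS
  obtain ⟨l, hl⟩ := hI
  rw [← Nat.not_even_iff_odd]
  rintro ⟨m, hm⟩
  omega

theorem petersenBd_ne_one {V : Type*} [Fintype V] (G : SimpleGraph V)
    (hbridge : ∀ e ∈ G.edgeSet, ¬ G.IsBridge e) (S : Set V) :
    (petersenBd G S).card ≠ 1 := by
  classical
  intro h
  obtain ⟨⟨a, b⟩, hab⟩ := Finset.card_eq_one.mp h
  have h1 : (a, b) ∈ petersenBd G S := by simp [hab]
  obtain ⟨ha, hb, hadj⟩ := (mem_petersenBd G S _).mp h1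
  have h2 := hbridge s(a, b) hadj
  rw [isBridge_iff, not_not] at h2
  obtain ⟨w⟩ := h2
  obtain ⟨d, -, hd1, hd2⟩ := w.exists_boundary_dart S ha hb
  have h3 := d.adj
  rw [deleteEdges_adj] at h3
  have h4 : (d.fst, d.snd) ∈ petersenBd G S := (mem_petersenBd G S _).mpr ⟨hd1, hd2, h3.1⟩
  rw [hab, Finset.mem_singleton, Prod.mk.injEq] at h4
  apply h3.2
  simp [h4.1, h4.2]

theorem stmt5 {V : Type*} [Fintype V] (G : SimpleGraph V) [DecidableRel G.Adj]
    (hconn : G.Connected) (hreg : G.IsRegularOfDegree 3)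
    (hbridge : ∀ e ∈ G.edgeSet, ¬ G.IsBridge e) :
    ∃ M : G.Subgraph, M.IsPerfectMatching := by
  classical
  rw [tutte]
  intro u hu
  unfold IsTutteViolator at hu
  let H := ((⊤ : G.Subgraph).deleteVerts u).coe
  let T : H.ConnectedComponent → Set V := fun c => Subtype.val '' c.supp
  let D : Finset (V × V) := Finset.univ.filter (fun p => p.2 ∈ u ∧ G.Adj p.1 p.2)
  have hD : D.card = u.ncard * 3 := by
    rw [← petersen_count G hreg u]
    refine Finset.card_bij' (fun p _ => p.swap) (fun p _ => p.swap) ?_ ?_ ?_ ?_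
    · rintro ⟨x, y⟩ h
      simpa [D, G.adj_comm] using h
    · rintro ⟨x, y⟩ h
      simpa [D, G.adj_comm] using h
    · simp
    · simp
  have hT : ∀ c, ∀ p ∈ petersenBd G (T c), p ∈ D := by
    rintro c ⟨a, b⟩ hp
    obtain ⟨⟨a', ha', rfl⟩, hb, hadj⟩ := (mem_petersenBd G _ _).mp hp
    simp only [D, Finset.mem_filter, Finset.mem_univ, true_and]
    refine ⟨?_, hadj⟩
    by_contra hbu
    apply hb
    have hbv : b ∈ ((⊤ : G.Subgraph).deleteVerts u).verts := by simpa using hbu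
    refine ⟨⟨b, hbv⟩, ?_, rfl⟩
    have hHa : H.Adj a' ⟨b, hbv⟩ := by
      have := a'.2
      simp only [Subgraph.deleteVerts_verts, Subgraph.verts_top, Set.mem_sdiff] at this
      simp [H, hbu, this.2]
      exact hadj
    exact (ConnectedComponent.mem_supp_congr_adj c hHa).mp ha'
  have h3 : ∀ c ∈ H.oddComponents, 3 ≤ (petersenBd G (T c)).card := by
    intro c hc
    have h1 : Odd (T c).ncard := by
      rw [Set.ncard_image_of_injective _ Subtype.val_injective]
      exact hc
    have h2 := petersenBd_odd G hreg _ h1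
    have h4 := petersenBd_ne_one G hbridge (T c)
    obtain ⟨k, hk⟩ := h2
    omega
  have hdisj : (H.oddComponents.toFinset : Set H.ConnectedComponent).PairwiseDisjoint
      (fun c => petersenBd G (T c)) := by
    intro c _ c' _ hne
    rw [Function.onFun, Finset.disjoint_left]
    intro p hp hp'
    obtain ⟨⟨a, ha, h1⟩, -⟩ := (mem_petersenBd G _ _).mp hp
    obtain ⟨⟨a', ha', h1'⟩, -⟩ := (mem_petersenBd G _ _).mp hp'
    have : a = a' := Subtype.ext (h1.trans h1'.symm)
    subst this
    exact hne (ha.symm.trans ha')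
  have hle : H.oddComponents.toFinset.card * 3 ≤ D.card := by
    calc _ ≤ ∑ c ∈ H.oddComponents.toFinset, (petersenBd G (T c)).card := by
          rw [← smul_eq_mul]
          apply Finset.card_nsmul_le_sum
          intro c hc
          exact h3 c (by simpa using hc)
      _ = (H.oddComponents.toFinset.biUnion (fun c => petersenBd G (T c))).card :=
          (Finset.card_biUnion hdisj).symm
      _ ≤ D.card := by
          apply Finset.card_le_card
          intro p hp
          obtain ⟨c, -, hc⟩ := Finset.mem_biUnion.mp hp
          exact hT c p hc
  rw [← Set.ncard_eq_toFinset_card'] at hle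
  change u.ncard < H.oddComponents.ncard at hu
  omega
end

section
/- If G is a 3-regular connected graph without cut edges, then pd(G) ≤ 2. -/
open SimpleGraph

variable {V : Type*}

open Classical in
/-- Darts leaving the preimage of `K`. -/
noncomputable def outD {V W : Type*} [Fintype V] (G : SimpleGraph V) (f : V → W) (K : Set W) :
    Finset (V × V) :=
  Finset.univ.filter fun p => G.Adj p.1 p.2 ∧ f p.1 ∈ K ∧ f p.2 ∉ K

theorem not_reach_of_inv {V : Type*} (G : SimpleGraph V) (P : V → Prop)
    (h : ∀ a b, G.Adj a b → P a → P b) {x y : V} (hx : P x) (hy : ¬ P y) : ¬ G.Reachable x y := by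
  rintro ⟨p⟩
  induction p with
  | nil => exact hy hx
  | cons hab p ih => exact ih (h _ _ hab hx) hy

theorem outD_ne_one {V W : Type*} [Fintype V] (G : SimpleGraph V) (f : V → W) (K : Set W)
    (hbridge : ∀ e ∈ G.edgeSet, ¬ G.IsBridge e) : (outD G f K).card ≠ 1 := by
  classical
  intro h
  obtain ⟨⟨a, b⟩, hab⟩ := Finset.card_eq_one.1 h
  have hm : ∀ p : V × V, (G.Adj p.1 p.2 ∧ f p.1 ∈ K ∧ f p.2 ∉ K) ↔ p = (a, b) := by
    intro p
    have : p ∈ outD G f K ↔ p ∈ ({(a, b)} : Finset (V × V)) := by rw [hab]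
    simpa [outD] using this
  have h0 := (hm (a, b)).2 rfl
  refine hbridge s(a, b) h0.1 ?_
  rw [isBridge_iff]
  refine not_reach_of_inv _ (fun v => f v ∈ K) ?_ h0.2.1 h0.2.2
  intro u v huv hu
  by_contra hv
  rw [deleteEdges_adj] at huv
  have := (hm (u, v)).1 ⟨huv.1, hu, hv⟩
  simp only [Prod.mk.injEq] at this
  apply huv.2
  simp [this.1, this.2]

theorem outD_parity {V W : Type*} [Fintype V] [Fintype W] (G : SimpleGraph V) (f : V → W)
    (h3 : ∀ w, (outD G f {w}).card = 3) (K : Finset W) :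
    (outD G f K).card % 2 = K.card % 2 := by
  classical
  let A := Finset.univ.filter fun p : V × V => G.Adj p.1 p.2 ∧ f p.1 ∈ K ∧ f p.1 ≠ f p.2
  have hA : A.card = K.card * 3 := by
    rw [Finset.card_eq_sum_card_fiberwise (f := fun p : V × V => f p.1) (t := K)]
    · rw [Finset.sum_const_nat]
      intro w hw
      rw [← h3 w]
      congr 1
      ext p
      simp only [A, outD, Finset.mem_filter, Finset.mem_univ, true_and, Set.mem_singleton_iff]
      grind
    · intro p hp
      simp only [A, Finset.coe_filter, Finset.mem_univ, true_and, Set.mem_ofPred_eq] at hp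
      exact hp.2.1
  let B := A.filter fun p => f p.2 ∈ K
  have hB : (B.card : ZMod 2) = 0 := by
    have : ∑ p ∈ B, (1 : ZMod 2) = 0 := by
      refine Finset.sum_involution (fun p _ => p.swap) ?_ ?_ ?_ ?_
      · intro _ _; decide
      · rintro ⟨a, b⟩ hp _ h
        simp only [Prod.swap_prod_mk, Prod.mk.injEq] at h
        simp only [B, A, Finset.mem_filter] at hp
        exact hp.1.2.2.2 (by rw [h.1])
      · rintro ⟨a, b⟩ hp
        simp only [B, A, Finset.mem_filter, Finset.mem_univ, true_and, Prod.swap_prod_mk] at hp ⊢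
        exact ⟨⟨hp.1.1.symm, hp.2, hp.1.2.2.symm⟩, hp.1.2.1⟩
      · intro p hp; simp
    simpa using this
  have hB2 : 2 ∣ B.card := (ZMod.natCast_eq_zero_iff _ _).1 hB
  have hC : outD G f K = A.filter fun p => ¬ f p.2 ∈ K := by
    ext p
    simp only [A, outD, Finset.mem_filter, Finset.mem_univ, true_and, Finset.mem_coe]
    grind
  have := Finset.card_filter_add_card_filter_not (s := A) (fun p => f p.2 ∈ K)
  rw [← hC] at this
  change B.card + _ = _ at this
  omega

/-- The quotient graph. -/
def quoG {V W : Type*} (G : SimpleGraph V) (f : V → W) : SimpleGraph W where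
  Adj w w' := w ≠ w' ∧ ∃ a b, G.Adj a b ∧ f a = w ∧ f b = w'
  symm := ⟨by
    rintro w w' ⟨h, a, b, hab, ha, hb⟩
    exact ⟨h.symm, b, a, hab.symm, hb, ha⟩⟩
  loopless := ⟨fun w h => h.1 rfl⟩

theorem quo_matching {V W : Type*} [Fintype V] [Fintype W] (G : SimpleGraph V) (f : V → W)
    (hbridge : ∀ e ∈ G.edgeSet, ¬ G.IsBridge e)
    (h3 : ∀ w, (outD G f {w}).card = 3) :
    ∃ M : (quoG G f).Subgraph, M.IsPerfectMatching := by
  classical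
  rw [SimpleGraph.tutte]
  intro U hU
  unfold IsTutteViolator at hU
  set H := ((⊤ : (quoG G f).Subgraph).deleteVerts U).coe with hH
  have hmem : ∀ w, w ∉ U → w ∈ ((⊤ : (quoG G f).Subgraph).deleteVerts U).verts := by
    intro w hw; simp [hw]
  have hmem' : ∀ w, w ∈ ((⊤ : (quoG G f).Subgraph).deleteVerts U).verts → w ∉ U := by
    intro w hw; simpa using hw
  let g : V × V → Option H.ConnectedComponent := fun p =>
    if h : f p.1 ∉ U then some (H.connectedComponentMk ⟨f p.1, hmem _ h⟩) else none
  let D : Finset (V × V) := Finset.univ.filter fun p => G.Adj p.1 p.2 ∧ f p.1 ∉ U ∧ f p.2 ∈ U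
  have hD1 : D.card ≤ 3 * U.toFinset.card := by
    refine Finset.card_le_mul_card_image_of_maps_to (f := fun p : V × V => f p.2) ?_ 3 ?_
    · intro p hp
      simp only [D, Finset.mem_filter] at hp
      simpa using hp.2.2.2
    · intro w hw
      rw [← h3 w]
      refine Finset.card_le_card_of_injOn Prod.swap ?_ Prod.swap_injective.injOn
      rintro ⟨a, b⟩ hp
      simp only [D, outD, Finset.coe_filter, Finset.mem_filter, Finset.mem_univ, true_and,
        Set.mem_ofPred_eq, Prod.swap_prod_mk, Set.mem_singleton_iff] at hp ⊢
      refine ⟨hp.1.1.symm, hp.2, ?_⟩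
      intro h
      apply hp.1.2.1
      rw [h, ← hp.2]; exact hp.1.2.2
  let O : Finset H.ConnectedComponent := H.oddComponents.toFinset
  have hD2 : 3 * O.card ≤ D.card := by
    have key : ∀ C ∈ O, 3 ≤ (D.filter fun p => g p = some C).card := by
      intro C hC
      let K : Finset W := (Subtype.val '' C.supp).toFinset
      have hKc : K.card % 2 = 1 := by
        have : Odd C.supp.ncard := by simpa [O] using hC
        rw [← Set.ncard_image_of_injective _ Subtype.val_injective] at this
        rw [Set.ncard_eq_toFinset_card'] at this
        exact Nat.odd_iff.1 this
      have hK : ∀ w, w ∈ K ↔ ∃ h : w ∉ U, H.connectedComponentMk ⟨w, hmem _ h⟩ = C := by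
        intro w
        simp only [K, Set.mem_toFinset, Set.mem_image, ConnectedComponent.mem_supp_iff]
        constructor
        · rintro ⟨⟨w', h'⟩, h1, rfl⟩
          exact ⟨hmem' _ h', h1⟩
        · rintro ⟨h, h1⟩
          exact ⟨_, h1, rfl⟩
      have hp := outD_parity G f h3 K
      have h1 := outD_ne_one G f (K : Set W) hbridge
      have hsub : outD G f K ⊆ D.filter fun p => g p = some C := by
        rintro ⟨a, b⟩ hp
        simp only [outD, Finset.mem_filter, Finset.mem_univ, true_and, Finset.mem_coe] at hp
        obtain ⟨hab, ha, hb⟩ := hp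
        obtain ⟨haU, hac⟩ := (hK _).1 ha
        have hbU : f b ∈ U := by
          by_contra hbU
          apply hb
          refine (hK _).2 ⟨hbU, ?_⟩
          rw [← hac]
          apply ConnectedComponent.sound
          by_cases hne : f a = f b
          · simp only [hne]; exact Reachable.refl _
          · apply Adj.reachable
            simp only [hH, Subgraph.coe_adj, Subgraph.deleteVerts_adj]
            refine ⟨by simp, hbU, by simp, haU, ?_⟩
            simp only [Subgraph.top_adj]
            exact ⟨fun h => hne h.symm, b, a, hab.symm, rfl, rfl⟩
        simp only [D, Finset.mem_filter, Finset.mem_univ, true_and]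
        exact ⟨⟨hab, haU, hbU⟩, by simp [g, haU, hac]⟩
      have := Finset.card_le_card hsub
      omega
    calc 3 * O.card = ∑ C ∈ O, 3 := by simp [mul_comm]
      _ ≤ ∑ C ∈ O, (D.filter fun p => g p = some C).card := Finset.sum_le_sum key
      _ = (O.biUnion fun C => D.filter fun p => g p = some C).card := by
        rw [Finset.card_biUnion]
        intro C _ C' _ hne
        change Disjoint (D.filter _) (D.filter _)
        rw [Finset.disjoint_left]
        intro p hp hp'
        simp only [Finset.mem_filter] at hp hp'
        exact hne (Option.some.inj (hp.2.symm.trans hp'.2))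
      _ ≤ D.card := by
        apply Finset.card_le_card
        intro p hp
        simp only [Finset.mem_biUnion, Finset.mem_filter] at hp
        obtain ⟨_, _, h, _⟩ := hp
        exact h
  have e1 : U.ncard = U.toFinset.card := Set.ncard_eq_toFinset_card' U
  have e2 : H.oddComponents.ncard = O.card := Set.ncard_eq_toFinset_card' _
  omega

/-- Lifting: exit vertices. -/
theorem quo_exits {V W : Type*} [Fintype V] [Fintype W] (G : SimpleGraph V) (f : V → W)
    (hbridge : ∀ e ∈ G.edgeSet, ¬ G.IsBridge e)
    (h3 : ∀ w, (outD G f {w}).card = 3) :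
    ∃ (mate : W → W) (ex : W → V), (∀ w, mate (mate w) = w) ∧ (∀ w, mate w ≠ w) ∧
      (∀ w, f (ex w) = w) ∧ ∀ w, G.Adj (ex w) (ex (mate w)) := by
  classical
  obtain ⟨M, hM⟩ := quo_matching G f hbridge h3
  rw [Subgraph.isPerfectMatching_iff] at hM
  choose mate hm1 hm2 using hM
  have hmm : ∀ w, mate (mate w) = w := fun w => (hm2 _ _ (hm1 w).symm).symm
  have hne : ∀ w, mate w ≠ w := fun w h => (hm1 w).ne h.symm
  have hg : ∀ e : Sym2 W, ∃ d : Sym2 V, e ∈ M.edgeSet → d ∈ G.edgeSet ∧ Sym2.map f d = e := by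
    intro e
    induction e using Sym2.ind with
    | _ w w' =>
      by_cases h : M.Adj w w'
      · obtain ⟨_, a, b, hab, rfl, rfl⟩ := M.adj_sub h
        exact ⟨s(a, b), fun _ => ⟨hab, rfl⟩⟩
      · have : Nonempty V := by
          by_contra hV
          rw [not_nonempty_iff] at hV
          have := h3 w
          rw [Finset.eq_empty_of_isEmpty (outD G f {w})] at this
          simp at this
        exact ⟨s(this.some, this.some), fun h' => absurd h' h⟩
  choose g hg using hg
  have hex : ∀ w, ∃ v, v ∈ g s(w, mate w) ∧ f v = w := by
    intro w
    obtain ⟨_, h2⟩ := hg s(w, mate w) (hm1 w)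
    have : w ∈ Sym2.map f (g s(w, mate w)) := by rw [h2]; simp
    rw [Sym2.mem_map] at this
    exact this
  choose ex hex1 hex2 using hex
  refine ⟨mate, ex, hmm, hne, hex2, fun w => ?_⟩
  have h1 := hex1 w
  have h2 := hex1 (mate w)
  rw [hmm, Sym2.eq_swap] at h2
  have h3 : ex w ≠ ex (mate w) := by
    intro h
    have := congrArg f h
    rw [hex2, hex2] at this
    exact hne w this.symm
  have := (Sym2.mem_and_mem_iff h3).1 ⟨h1, h2⟩
  have h4 := (hg s(w, mate w) (hm1 w)).1
  rw [this] at h4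
  exact h4

theorem deg3_mem {V : Type*} [Fintype V] (G : SimpleGraph V) [DecidableRel G.Adj]
    (hreg : G.IsRegularOfDegree 3) {v a b c d : V} (ha : G.Adj v a) (hb : G.Adj v b)
    (hc : G.Adj v c) (hd : G.Adj v d) (hab : a ≠ b) (hac : a ≠ c) (hbc : b ≠ c) :
    d = a ∨ d = b ∨ d = c := by
  classical
  have h3 : ({a, b, c} : Finset V).card = 3 := Finset.card_eq_three.2 ⟨a, b, c, hab, hac, hbc, rfl⟩
  have hs : ({a, b, c} : Finset V) ⊆ G.neighborFinset v := by
    intro x hx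
    simp only [Finset.mem_insert, Finset.mem_singleton] at hx
    rw [mem_neighborFinset]
    rcases hx with rfl | rfl | rfl <;> assumption
  have := Finset.eq_of_subset_of_card_le hs (by rw [h3]; exact (hreg v).le)
  have hd' : d ∈ G.neighborFinset v := by rwa [mem_neighborFinset]
  rw [← this] at hd'
  simpa using hd'

theorem outD_single {V : Type*} [Fintype V] (G : SimpleGraph V) [DecidableRel G.Adj]
    (hreg : G.IsRegularOfDegree 3) (S : Finset V) (hS : S.card = 1 ∨ G.IsNClique 3 S) :
    (outD G id (S : Set V)).card = 3 := by
  classical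
  have hcount : (outD G id (S : Set V)).card = ∑ v ∈ S, (G.neighborFinset v \ S).card := by
    rw [← Finset.card_sigma]
    refine Finset.card_bij (fun p _ => ⟨p.1, p.2⟩) ?_ ?_ ?_
    · intro p hp
      simp only [outD, Finset.mem_filter, Finset.mem_univ, true_and, Finset.mem_coe, id] at hp
      simp [hp]
    · rintro ⟨a, b⟩ _ ⟨a', b'⟩ _ h
      simpa using h
    · rintro ⟨a, b⟩ h
      simp only [Finset.mem_sigma, Finset.mem_sdiff, mem_neighborFinset] at h
      exact ⟨(a, b), by simp [outD, h], rfl⟩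
  rw [hcount]
  rcases hS with hS | hS
  · obtain ⟨v, rfl⟩ := Finset.card_eq_one.1 hS
    rw [Finset.sum_singleton, Finset.sdiff_singleton_eq_erase, Finset.erase_eq_of_notMem]
    · exact hreg v
    · simp
  · have : ∀ v ∈ S, (G.neighborFinset v \ S).card = 1 := by
      intro v hv
      have h1 : S ∩ G.neighborFinset v = S.erase v := by
        ext u
        simp only [Finset.mem_inter, mem_neighborFinset, Finset.mem_erase]
        constructor
        · rintro ⟨h1, h2⟩; exact ⟨h2.ne', h1⟩
        · rintro ⟨h1, h2⟩; exact ⟨h2, hS.isClique hv h2 h1.symm⟩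
      rw [Finset.card_sdiff, h1, Finset.card_erase_of_mem hv, hS.card_eq]
      have := hreg v
      unfold degree at this
      omega
    rw [Finset.sum_congr rfl this]
    simp [hS.card_eq]

set_option maxHeartbeats 1000000 in
/-- A perfect matching (as a relation) meeting every triangle. -/
theorem exists_good_matching {V : Type*} [Fintype V] (G : SimpleGraph V) [DecidableRel G.Adj]
    (hreg : G.IsRegularOfDegree 3) (hbridge : ∀ e ∈ G.edgeSet, ¬ G.IsBridge e) :
    ∃ N : V → V → Prop, (∀ a b, N a b → N b a) ∧ (∀ a b, N a b → G.Adj a b) ∧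
      (∀ a, ∃ b, N a b) ∧ (∀ a b c, N a b → N a c → b = c) ∧
      ∀ a b c, G.Adj a b → G.Adj b c → G.Adj a c → N a b ∨ N b c ∨ N a c := by
  classical
  -- maximal family of disjoint triangles
  let P : Finset (Finset V) → Prop := fun F =>
    (∀ T ∈ F, G.IsNClique 3 T) ∧ ∀ T ∈ F, ∀ T' ∈ F, ∀ v, v ∈ T → v ∈ T' → T = T'
  obtain ⟨F, hF, hmax⟩ : ∃ F, P F ∧ ∀ F', P F' → F ⊆ F' → F' = F := by
    obtain ⟨F, hF, hm⟩ := Finset.exists_max_image (Finset.univ.filter P) Finset.card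
      ⟨∅, by simp [P]⟩
    simp only [Finset.mem_filter, Finset.mem_univ, true_and] at hF hm
    exact ⟨F, hF, fun F' h1 h2 => (Finset.eq_of_subset_of_card_le h2 (hm F' h1)).symm⟩
  obtain ⟨hF1, hF2⟩ := hF
  let f0 : V → Finset V := fun v => if h : ∃ T ∈ F, v ∈ T then h.choose else {v}
  have f0T : ∀ v, ∀ T ∈ F, v ∈ T → f0 v = T := by
    intro v T hT hv
    have h : ∃ T ∈ F, v ∈ T := ⟨T, hT, hv⟩
    simp only [f0, h, dif_pos]
    exact hF2 _ h.choose_spec.1 _ hT v h.choose_spec.2 hv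
  have f0S : ∀ v, (¬ ∃ T ∈ F, v ∈ T) → f0 v = {v} := by
    intro v h
    simp only [f0, h, dif_neg, not_false_eq_true]
  have hself : ∀ v, v ∈ f0 v := by
    intro v
    by_cases h : ∃ T ∈ F, v ∈ T
    · obtain ⟨T, hT, hv⟩ := h
      rw [f0T v T hT hv]; exact hv
    · rw [f0S v h]; simp
  have hmem : ∀ u v, u ∈ f0 v ↔ f0 u = f0 v := by
    intro u v
    constructor
    · intro hu
      by_cases h : ∃ T ∈ F, v ∈ T
      · obtain ⟨T, hT, hv⟩ := h
        rw [f0T v T hT hv] at hu ⊢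
        exact f0T u T hT hu
      · rw [f0S v h] at hu
        rw [Finset.mem_singleton.1 hu]
    · intro h; rw [← h]; exact hself u
  have hkind : ∀ v, f0 v = {v} ∨ (f0 v ∈ F ∧ G.IsNClique 3 (f0 v)) := by
    intro v
    by_cases h : ∃ T ∈ F, v ∈ T
    · obtain ⟨T, hT, hv⟩ := h
      rw [f0T v T hT hv]; exact Or.inr ⟨hT, hF1 T hT⟩
    · exact Or.inl (f0S v h)
  let f : V → Set.range f0 := Set.rangeFactorization f0
  have hf : ∀ u v, f u = f v ↔ f0 u = f0 v := by
    intro u v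
    simp [f, Set.rangeFactorization, Subtype.ext_iff]
  have h3 : ∀ w, (outD G f {w}).card = 3 := by
    rintro ⟨_, v, rfl⟩
    rw [← outD_single G hreg (f0 v) ?_]
    · congr 1
      ext p
      simp only [outD, Finset.mem_filter, Finset.mem_univ, true_and, Set.mem_singleton_iff,
        Finset.mem_coe, id, hmem]
      change _ ∧ f p.1 = f v ∧ ¬ f p.2 = f v ↔ _
      rw [hf, hf]
    · rcases hkind v with h | h
      · left; rw [h]; simp
      · exact Or.inr h.2
  obtain ⟨mate, ex, hmm, hmne, hfex, hadj⟩ := quo_exits G f hbridge h3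
  let N : V → V → Prop := fun a b =>
    (a = ex (f a) ∧ b = ex (mate (f a))) ∨
    (f a = f b ∧ a ≠ b ∧ a ≠ ex (f a) ∧ b ≠ ex (f a))
  have hNsymm : ∀ a b, N a b → N b a := by
    rintro a b (⟨h1, h2⟩ | ⟨h1, h2, h3, h4⟩)
    · left
      have : f b = mate (f a) := by rw [h2, hfex]
      rw [this, hmm]
      exact ⟨h2, h1⟩
    · right
      rw [← h1]
      exact ⟨rfl, h2.symm, h4, h3⟩
  have hNadj : ∀ a b, N a b → G.Adj a b := by
    rintro a b (⟨h1, h2⟩ | ⟨h1, h2, h3, h4⟩)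
    · rw [h1, h2]
      exact hadj _
    · have hab := (hmem a b).2 ((hf _ _).1 h1)
      rcases hkind b with h | h
      · rw [h] at hab; exact absurd (Finset.mem_singleton.1 hab) h2
      · exact h.2.isClique hab (hself b) h2
  have hexmem : ∀ a, ex (f a) ∈ f0 a := fun a => (hmem _ _).2 ((hf _ _).1 (hfex _))
  have hcard : ∀ a, a ≠ ex (f a) → (f0 a).card = 3 := by
    intro a ha
    rcases hkind a with h | h
    · have := hexmem a
      rw [h] at this
      exact absurd (Finset.mem_singleton.1 this).symm ha
    · exact h.2.card_eq
  have hc1 : ∀ a, a ≠ ex (f a) → (((f0 a).erase a).erase (ex (f a))).card = 1 := by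
    intro a ha
    rw [Finset.card_erase_of_mem, Finset.card_erase_of_mem (hself a), hcard a ha]
    exact Finset.mem_erase.2 ⟨ha.symm, hexmem a⟩
  have hNex : ∀ a, ∃ b, N a b := by
    intro a
    by_cases ha : a = ex (f a)
    · exact ⟨_, Or.inl ⟨ha, rfl⟩⟩
    · obtain ⟨b, hb⟩ := Finset.card_eq_one.1 (hc1 a ha)
      have hb' : b ∈ ((f0 a).erase a).erase (ex (f a)) := by rw [hb]; simp
      simp only [Finset.mem_erase] at hb'
      exact ⟨b, Or.inr ⟨(hf _ _).2 ((hmem _ _).1 hb'.2.2).symm, fun h => hb'.2.1 h.symm, ha, hb'.1⟩⟩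
  have hNuniq : ∀ a b c, N a b → N a c → b = c := by
    rintro a b c (⟨h1, h2⟩ | ⟨h1, h2, h3, h4⟩) (⟨k1, k2⟩ | ⟨k1, k2, k3, k4⟩)
    · rw [h2, k2]
    · exact absurd h1 k3
    · exact absurd k1 h3
    · refine Finset.card_le_one.1 (hc1 a h3).le b ?_ c ?_
      · simp only [Finset.mem_erase]
        exact ⟨h4, h2.symm, (hmem _ _).2 ((hf _ _).1 h1.symm)⟩
      · simp only [Finset.mem_erase]
        exact ⟨k4, k2.symm, (hmem _ _).2 ((hf _ _).1 k1.symm)⟩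
  refine ⟨N, hNsymm, hNadj, hNex, hNuniq, ?_⟩
  intro a b c hab hbc hac
  by_contra hno
  push Not at hno
  obtain ⟨n1, n2, n3⟩ := hno
  -- two triangles sharing the edge x y
  have share : ∀ x y z r, G.Adj x y → G.Adj y z → G.Adj x z → G.Adj x r → G.Adj y r → r ≠ z →
      ¬ N x y → ¬ N y z → ¬ N x z → False := by
    intro x y z r hxy hyz hxz hxr hyr hrz m1 m2 m3
    have hx : N x r := by
      obtain ⟨t, ht⟩ := hNex x
      rcases deg3_mem G hreg hxy hxz hxr (hNadj _ _ ht) hyz.ne hyr.ne hrz.symm with h | h | h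
      · rw [h] at ht; exact absurd ht m1
      · rw [h] at ht; exact absurd ht m3
      · rwa [h] at ht
    have hy : N y r := by
      obtain ⟨t, ht⟩ := hNex y
      rcases deg3_mem G hreg hxy.symm hyz hyr (hNadj _ _ ht) hxz.ne hxr.ne hrz.symm with h | h | h
      · rw [h] at ht; exact absurd (hNsymm _ _ ht) m1
      · rw [h] at ht; exact absurd ht m2
      · rwa [h] at ht
    exact hxy.ne (hNuniq r x y (hNsymm _ _ hx) (hNsymm _ _ hy))
  -- a triangle sharing the vertex x
  have share1 : ∀ x y z q r, G.Adj x y → G.Adj y z → G.Adj x z → G.Adj x q → G.Adj x r →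
      G.Adj q r → ¬ N x y → ¬ N y z → ¬ N x z → (q = y ∧ r = z) ∨ (q = z ∧ r = y) := by
    intro x y z q r hxy hyz hxz hxq hxr hqr m1 m2 m3
    have m2' : ¬ N z y := fun h => m2 (hNsymm _ _ h)
    by_cases hqy : q = y
    · subst hqy
      left; refine ⟨rfl, ?_⟩
      by_contra hrz
      exact share x q z r hxy hyz hxz hxr hqr hrz m1 m2 m3
    by_cases hqz : q = z
    · subst hqz
      right; refine ⟨rfl, ?_⟩
      by_contra hry
      exact share x q y r hxz hyz.symm hxy hxr hqr hry m3 m2' m1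
    exfalso
    rcases deg3_mem G hreg hxy hxz hxq hxr hyz.ne (Ne.symm hqy) (Ne.symm hqz) with h | h | h
    · subst h
      exact share x r z q hxy hyz hxz hxq hqr.symm hqz m1 m2 m3
    · subst h
      exact share x r y q hxz hyz.symm hxy hxq hqr.symm hqy m3 m2' m1
    · exact hqr.ne h.symm
  have share2 : ∀ x y z, G.Adj x y → G.Adj y z → G.Adj x z → ¬ N x y → ¬ N y z → ¬ N x z →
      ∀ T, G.IsNClique 3 T → x ∈ T → T = {x, y, z} := by
    intro x y z hxy hyz hxz m1 m2 m3 T hT hxT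
    obtain ⟨q, r, hqr, hqr'⟩ := Finset.card_eq_two.1
      (show (T.erase x).card = 2 by rw [Finset.card_erase_of_mem hxT, hT.card_eq])
    have hTe : T = {x, q, r} := by rw [← hqr', Finset.insert_erase hxT]
    have hq : q ∈ T.erase x := by rw [hqr']; simp
    have hr : r ∈ T.erase x := by rw [hqr']; simp
    rw [Finset.mem_erase] at hq hr
    rcases share1 x y z q r hxy hyz hxz (hT.isClique hxT hq.2 hq.1.symm)
      (hT.isClique hxT hr.2 hr.1.symm) (hT.isClique hq.2 hr.2 hqr) m1 m2 m3 with ⟨h, h'⟩ | ⟨h, h'⟩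
    · rw [hTe, h, h']
    · rw [hTe, h, h', Finset.pair_comm]
  have hT0 : G.IsNClique 3 {a, b, c} := is3Clique_triple_iff.2 ⟨hab, hac, hbc⟩
  have nn1 : ¬ N b a := fun h => n1 (hNsymm _ _ h)
  have nn2 : ¬ N c b := fun h => n2 (hNsymm _ _ h)
  have nn3 : ¬ N c a := fun h => n3 (hNsymm _ _ h)
  have hall : ∀ T, G.IsNClique 3 T → ∀ v, v ∈ T → v ∈ ({a, b, c} : Finset V) → T = {a, b, c} := by
    intro T hT v hv hv'
    simp only [Finset.mem_insert, Finset.mem_singleton] at hv'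
    rcases hv' with rfl | rfl | rfl
    · exact share2 _ _ _ hab hbc hac n1 n2 n3 T hT hv
    · rw [share2 _ _ _ hab.symm hac hbc nn1 n3 n2 T hT hv, Finset.insert_comm]
    · rw [share2 _ _ _ hac.symm hab hbc.symm nn3 n1 nn2 T hT hv, Finset.insert_comm, Finset.pair_comm]
  have hTF : ({a, b, c} : Finset V) ∈ F := by
    have : insert {a, b, c} F = F := by
      refine hmax _ ⟨?_, ?_⟩ (Finset.subset_insert _ _)
      · intro T hT
        rcases Finset.mem_insert.1 hT with rfl | h
        · exact hT0
        · exact hF1 T h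
      · intro T hT T' hT' v hv hv'
        rcases Finset.mem_insert.1 hT with rfl | h <;> rcases Finset.mem_insert.1 hT' with rfl | h'
        · rfl
        · exact (hall T' (hF1 _ h') v hv' hv).symm
        · exact hall T (hF1 _ h) v hv hv'
        · exact hF2 T h T' h' v hv hv'
    rw [← this]; exact Finset.mem_insert_self _ _
  have ea := f0T a _ hTF (by simp)
  have eb := f0T b _ hTF (by simp)
  have ec := f0T c _ hTF (by simp)
  have fab : f a = f b := (hf _ _).2 (ea.trans eb.symm)
  have fac : f a = f c := (hf _ _).2 (ea.trans ec.symm)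
  have h1 : a = ex (f a) ∨ b = ex (f a) := by
    by_contra h; push Not at h
    exact n1 (Or.inr ⟨fab, hab.ne, h.1, h.2⟩)
  have h2 : a = ex (f a) ∨ c = ex (f a) := by
    by_contra h; push Not at h
    exact n3 (Or.inr ⟨fac, hac.ne, h.1, h.2⟩)
  have h3 : b = ex (f a) ∨ c = ex (f a) := by
    by_contra h; push Not at h
    exact n2 (Or.inr ⟨fab.symm.trans fac, hbc.ne, by rw [← fab]; exact h.1, by rw [← fab]; exact h.2⟩)
  have := hab.ne
  have := hac.ne
  have := hbc.ne
  grind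

theorem stmt6 {V : Type*} [Fintype V] (G : SimpleGraph V) [DecidableRel G.Adj]
    (hconn : G.Connected) (hreg : G.IsRegularOfDegree 3)
    (hbridge : ∀ e ∈ G.edgeSet, ¬ G.IsBridge e) :
    pd G ≤ 2 := by
  classical
  obtain ⟨N, hsymm, hadj, hex, huniq, htri⟩ := exists_good_matching G hreg hbridge
  let c : Sym2 V → ℕ := fun e => if ∃ a b, e = s(a, b) ∧ N a b then 0 else 1
  have hc : ∀ a b, c s(a, b) = if N a b then 0 else 1 := by
    intro a b
    have : (∃ a' b', s(a, b) = s(a', b') ∧ N a' b') ↔ N a b := by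
      constructor
      · rintro ⟨a', b', h, hN⟩
        rcases Sym2.eq_iff.1 h with ⟨rfl, rfl⟩ | ⟨rfl, rfl⟩
        · exact hN
        · exact hsymm _ _ hN
      · intro h; exact ⟨a, b, rfl, h⟩
    simp only [c, this]
  apply Nat.sInf_le
  refine ⟨c, fun e _ => by simp only [c]; split_ifs <;> omega, fun x y hxy => ?_⟩
  -- choose w
  obtain ⟨w, hyw, hNw, hwx⟩ : ∃ w, G.Adj y w ∧ ¬ N y w ∧ w ≠ x := by
    obtain ⟨m, hm⟩ := hex y
    have hcard : 0 < (((G.neighborFinset y).erase m).erase x).card := by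
      have h1 := Finset.pred_card_le_card_erase (s := G.neighborFinset y) (a := m)
      have h2 := Finset.pred_card_le_card_erase (s := (G.neighborFinset y).erase m) (a := x)
      have h3 : (G.neighborFinset y).card = 3 := hreg y
      omega
    obtain ⟨w, hw⟩ := Finset.card_pos.1 hcard
    simp only [Finset.mem_erase, mem_neighborFinset] at hw
    exact ⟨w, hw.2.2, fun h => hw.2.1 (huniq _ _ _ h hm), hw.1⟩
  let S : V → Prop := fun v => v = y ∨ v = w
  let F : Set (Sym2 V) := {e | ∃ a b, e = s(a, b) ∧ G.Adj a b ∧ S a ∧ ¬ S b}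
  have hFv : ∀ e ∈ F, ∀ v ∈ e, ∃ a, e = s(v, a) ∧ G.Adj v a ∧ (S v ↔ ¬ S a) := by
    rintro e ⟨a, b, rfl, hab, ha, hb⟩ v hv
    rcases Sym2.mem_iff.1 hv with rfl | rfl
    · exact ⟨b, rfl, hab, by tauto⟩
    · exact ⟨a, Sym2.eq_swap, hab.symm, by tauto⟩
  refine ⟨F, ⟨?_, ?_⟩, ?_⟩
  · rintro e ⟨a, b, rfl, hab, -⟩
    exact hab
  · refine not_reach_of_inv _ (fun v => ¬ S v) ?_ ?_ ?_
    · intro a b hab ha hb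
      rw [deleteEdges_adj] at hab
      exact hab.2 ⟨b, a, Sym2.eq_swap, hab.1.symm, hb, ha⟩
    · rintro (h | h)
      · exact hxy h
      · exact hwx h.symm
    · simp [S]
  · rintro e₁ h1 e₂ h2 ⟨hne, v, hv1, hv2⟩
    obtain ⟨a, rfl, hva, hSa⟩ := hFv _ h1 v hv1
    obtain ⟨b, rfl, hvb, hSb⟩ := hFv _ h2 v hv2
    have hab : a ≠ b := by rintro rfl; exact hne rfl
    rw [hc, hc]
    have huv := huniq v a b
    suffices h : N v a ∨ N v b by
      by_cases ha : N v a <;> by_cases hb : N v b <;> simp [ha, hb]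
      · exact hab (huv ha hb)
      · tauto
    have inside : ∀ u, G.Adj v u → ¬ N v u → a ≠ u → b ≠ u → N v a ∨ N v b := by
      intro u hvu hNu hau hbu
      obtain ⟨t, ht⟩ := hex v
      rcases deg3_mem G hreg hva hvb hvu (hadj _ _ ht) hab hau hbu with h | h | h
      · rw [h] at ht; exact Or.inl ht
      · rw [h] at ht; exact Or.inr ht
      · rw [h] at ht; exact absurd ht hNu
    by_cases hSv : S v
    · have ha : ¬ S a := hSa.1 hSv
      have hb : ¬ S b := hSb.1 hSv
      simp only [S, not_or] at ha hb
      rcases hSv with rfl | rfl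
      · exact inside w hyw hNw ha.2 hb.2
      · exact inside y hyw.symm (fun h => hNw (hsymm _ _ h)) ha.1 hb.1
    · have ha : S a := by tauto
      have hb : S b := by tauto
      have := htri v y w
      rcases ha with rfl | rfl <;> rcases hb with rfl | rfl
      · exact absurd rfl hab
      · have := htri v a b hva hyw hvb
        tauto
      · have := htri v b a hvb hyw hva
        tauto
      · exact absurd rfl hab
end

section
/- If G is a connected 3-regular graph of order n ≥ 4, then pd(G) ≤ 2. -/
open SimpleGraph

variable {V : Type*}

section core

/-- residual adjacency: edges of `H` not in the matching given by `m` -/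
def Rad (H : SimpleGraph V) (m : V → V) (v w : V) : Prop := H.Adj v w ∧ w ≠ m v

/-- residual triangles -/
def Tri (H : SimpleGraph V) (m : V → V) (a b c : V) : Prop :=
  Rad H m a b ∧ Rad H m b c ∧ Rad H m a c

variable {H : SimpleGraph V} {m : V → V}

theorem Rad.symm' (hm : ∀ v, m (m v) = v) {v w : V} (h : Rad H m v w) : Rad H m w v := by
  refine ⟨h.1.symm, fun e => h.2 ?_⟩
  rw [e, hm]

theorem Rad.ne' {v w : V} (h : Rad H m v w) : v ≠ w := h.1.ne

theorem Tri.rot (hm : ∀ v, m (m v) = v) {a b c : V} (h : Tri H m a b c) : Tri H m b c a :=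
  ⟨h.2.1, h.2.2.symm' hm, h.1.symm' hm⟩

theorem Tri.swap (hm : ∀ v, m (m v) = v) {a b c : V} (h : Tri H m a b c) : Tri H m b a c :=
  ⟨h.1.symm' hm, h.2.2, h.2.1⟩

/-- residual graph has max degree two -/
def Deg2 (H : SimpleGraph V) (m : V → V) : Prop :=
  ∀ v w₁ w₂ w₃, Rad H m v w₁ → Rad H m v w₂ → Rad H m v w₃ → w₁ = w₂ ∨ w₁ = w₃ ∨ w₂ = w₃

theorem Tri.closed (hd : Deg2 H m) {a b c w : V} (h : Tri H m a b c) (hw : Rad H m a w) :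
    w = b ∨ w = c := by
  have h1 := hd a b c w h.1 h.2.2 hw
  have h2 := h.2.1.ne'
  grind

/-- `Z` cuts residual edges in a matching, and no triangle edges -/
def Clean (H : SimpleGraph V) (m : V → V) (Z : Set V) : Prop :=
  (∀ v w₁ w₂, Rad H m v w₁ → Rad H m v w₂ → ¬ (v ∈ Z ↔ w₁ ∈ Z) → ¬ (v ∈ Z ↔ w₂ ∈ Z) → w₁ = w₂) ∧
  (∀ v w, Rad H m v w → ¬ (v ∈ Z ↔ w ∈ Z) → ∀ t, ¬ Tri H m v w t)

theorem clean_empty : Clean H m ∅ := by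
  constructor <;> simp

theorem clean_univ : Clean H m Set.univ := by
  constructor <;> simp

theorem exists_clean (hm : ∀ v, m (m v) = v) (hd : Deg2 H m) {x y : V} (hxy : x ≠ y)
    (hT : ∀ t, ¬ Tri H m x y t) : ∃ Z, Clean H m Z ∧ x ∈ Z ∧ y ∉ Z := by
  by_cases h1 : ∃ a b, Tri H m x a b
  · obtain ⟨a, b, hab⟩ := h1
    have ca : ∀ w, Rad H m x w → w = a ∨ w = b := fun w hw => hab.closed hd hw
    have cb : ∀ w, Rad H m a w → w = b ∨ w = x := fun w hw => (hab.rot hm).closed hd hw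
    have cc : ∀ w, Rad H m b w → w = x ∨ w = a := fun w hw => ((hab.rot hm).rot hm).closed hd hw
    have key : ∀ v w, Rad H m v w → (v ∈ ({x, a, b} : Set V) ↔ w ∈ ({x, a, b} : Set V)) := by
      intro v w hvw
      have hwv := hvw.symm' hm
      simp only [Set.mem_insert_iff, Set.mem_singleton_iff]
      constructor
      · rintro (rfl | rfl | rfl)
        · have := ca _ hvw; tauto
        · have := cb _ hvw; tauto
        · have := cc _ hvw; tauto
      · rintro (rfl | rfl | rfl)
        · have := ca _ hwv; tauto
        · have := cb _ hwv; tauto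
        · have := cc _ hwv; tauto
    refine ⟨{x, a, b}, ⟨fun v w₁ w₂ r1 _ n _ => absurd (key _ _ r1) n,
      fun v w r n => absurd (key _ _ r) n⟩, by simp, ?_⟩
    simp only [Set.mem_insert_iff, Set.mem_singleton_iff, not_or]
    refine ⟨hxy.symm, ?_, ?_⟩
    · rintro rfl; exact hT _ hab
    · rintro rfl; exact hT _ (((hab.rot hm).rot hm).swap hm)
  · push Not at h1
    by_cases h2 : ∃ x', Rad H m x x' ∧ x' ≠ y
    · obtain ⟨x', hx', hy⟩ := h2
      have hx'' := hx'.symm' hm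
      have nx' : ∀ a b, ¬ Tri H m x' a b := by
        intro a b hab
        rcases hab.closed hd hx'' with rfl | rfl
        · exact h1 _ _ (hab.rot hm)
        · exact h1 _ _ ((hab.rot hm).rot hm)
      refine ⟨{x, x'}, ⟨?_, ?_⟩, by simp, by simp; tauto⟩
      · intro v w₁ w₂ r1 r2 n1 n2
        have s1 := r1.symm' hm
        have s2 := r2.symm' hm
        simp only [Set.mem_insert_iff, Set.mem_singleton_iff] at n1 n2
        by_contra hne
        by_cases hv : v = x ∨ v = x'
        · rcases hv with rfl | rfl
          · have := hd _ _ _ _ hx' r1 r2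
            grind
          · have := hd _ _ _ _ hx'' r1 r2
            grind
        · have e1 : w₁ = x ∨ w₁ = x' := by tauto
          have e2 : w₂ = x ∨ w₂ = x' := by tauto
          rcases e1 with rfl | rfl <;> rcases e2 with rfl | rfl
          · exact hne rfl
          · exact h1 _ _ ⟨hx', s2, s1⟩
          · exact h1 _ _ ⟨hx', s1, s2⟩
          · exact hne rfl
      · intro v w r n t ht
        simp only [Set.mem_insert_iff, Set.mem_singleton_iff] at n
        have hh : (v = x ∨ v = x') ∨ (w = x ∨ w = x') := by tauto
        rcases hh with (rfl | rfl) | (rfl | rfl)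
        · exact h1 _ _ ht
        · exact nx' _ _ ht
        · exact h1 _ _ (ht.rot hm)
        · exact nx' _ _ (ht.rot hm)
    · push Not at h2
      refine ⟨{x}, ⟨?_, ?_⟩, by simp, by simp; tauto⟩
      · intro v w₁ w₂ r1 r2 n1 n2
        simp only [Set.mem_singleton_iff] at n1 n2
        by_cases hv : v = x
        · subst hv
          rw [h2 _ r1, h2 _ r2]
        · have e1 : w₁ = x := by tauto
          have e2 : w₂ = x := by tauto
          rw [e1, e2]
      · intro v w r n t ht
        simp only [Set.mem_singleton_iff] at n
        have hh : v = x ∨ w = x := by tauto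
        rcases hh with rfl | rfl
        · exact h1 _ _ ht
        · exact h1 _ _ (ht.rot hm)

/-- the set of edges crossing `S` is properly coloured. -/
def ProperSet (H : SimpleGraph V) (c : Sym2 V → ℕ) (S : Set V) : Prop :=
  ∀ v w₁ w₂, H.Adj v w₁ → H.Adj v w₂ → w₁ ≠ w₂ → ¬ (v ∈ S ↔ w₁ ∈ S) → ¬ (v ∈ S ↔ w₂ ∈ S) →
    c s(v, w₁) ≠ c s(v, w₂)

/-- `a`, `b` have matching partners lying in a common residual triangle -/
def BadPair (H : SimpleGraph V) (m : V → V) (a b : V) : Prop :=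
  H.Adj a (m a) ∧ H.Adj b (m b) ∧ ∃ t, Tri H m (m a) (m b) t

theorem BadPair.symm' (hm : ∀ v, m (m v) = v) {a b : V} (h : BadPair H m a b) :
    BadPair H m b a := by
  obtain ⟨h1, h2, t, ht⟩ := h
  exact ⟨h2, h1, t, ht.swap hm⟩

theorem exists_apex (hm : ∀ v, m (m v) = v) (hd : Deg2 H m)
    (hP : ∀ a b c, Tri H m a b c → Tri H m (m a) (m b) (m c) →
      H.Adj a (m a) → H.Adj b (m b) → H.Adj c (m c) → False) :
    ∃ A : Set V, ∀ a b c, Tri H m a b c → (a ∈ A ∨ b ∈ A ∨ c ∈ A) ∧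
      (c ∈ A → a ∉ A ∧ b ∉ A ∧ ¬ BadPair H m a b) := by
  rcases isEmpty_or_nonempty V with hemp | hne
  · exact ⟨∅, fun a => (hemp.false a).elim⟩
  have h1 : ∀ T : Set V, ∃ t, ∀ a b c, T = {a, b, c} → Tri H m a b c →
      (t = a ∧ ¬ BadPair H m b c) ∨ (t = b ∧ ¬ BadPair H m a c) ∨ (t = c ∧ ¬ BadPair H m a b) := by
    intro T
    by_cases hT : ∃ a b c, T = {a, b, c} ∧ Tri H m a b c
    · obtain ⟨a, b, c, rfl, ht⟩ := hT
      have hsome : ∃ t, (t = a ∧ ¬ BadPair H m b c) ∨ (t = b ∧ ¬ BadPair H m a c) ∨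
          (t = c ∧ ¬ BadPair H m a b) := by
        by_contra hcon
        push Not at hcon
        have k1 : BadPair H m b c := by have := hcon a; tauto
        have k2 : BadPair H m a c := by have := hcon b; tauto
        have k3 : BadPair H m a b := by have := hcon c; tauto
        obtain ⟨p1, p2, t1, q1⟩ := k1
        obtain ⟨p3, p4, t2, q2⟩ := k2
        obtain ⟨p5, p6, t3, q3⟩ := k3
        exact hP a b c ht ⟨q3.1, q1.1, q2.1⟩ p3 p1 p2
      obtain ⟨t, ht'⟩ := hsome
      refine ⟨t, ?_⟩
      intro a' b' c' he ht''
      have n1 := ht.1.ne'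
      have n2 := ht.2.1.ne'
      have n3 := ht.2.2.ne'
      have m1 := ht''.1.ne'
      have m2 := ht''.2.1.ne'
      have m3 := ht''.2.2.ne'
      have ea : a' ∈ ({a, b, c} : Set V) := by rw [he]; simp
      have eb : b' ∈ ({a, b, c} : Set V) := by rw [he]; simp
      have ec : c' ∈ ({a, b, c} : Set V) := by rw [he]; simp
      simp only [Set.mem_insert_iff, Set.mem_singleton_iff] at ea eb ec
      have sy : ∀ u v, BadPair H m u v ↔ BadPair H m v u :=
        fun u v => ⟨fun h => h.symm' hm, fun h => h.symm' hm⟩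
      have s1 := sy a b
      have s2 := sy b c
      have s3 := sy a c
      clear he hP sy ht ht'' hd hm
      generalize BadPair H m = B at *
      rcases ea with rfl | rfl | rfl <;> rcases eb with rfl | rfl | rfl <;>
        first | exact absurd rfl m1 | grind
    · exact ⟨hne.some, fun a b c h h' => absurd ⟨a, b, c, h, h'⟩ hT⟩
  choose f hf using h1
  refine ⟨{t | ∃ a b, Tri H m a b t ∧ f {a, b, t} = t}, ?_⟩
  intro a b c ht
  have hset : ∀ p q r, Tri H m p q r → (r = a ∨ r = b ∨ r = c) → ({p, q, r} : Set V) = {a, b, c} := by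
    intro p q r h hr
    have hr1 := ((h.rot hm).rot hm)
    have n := h.1.ne'
    have ht2 := ht.rot hm
    have ht3 := ht2.rot hm
    rcases hr with rfl | rfl | rfl
    · have e1 := ht.closed hd hr1.1
      have e2 := ht.closed hd hr1.2.2
      ext z; simp only [Set.mem_insert_iff, Set.mem_singleton_iff]; grind
    · have e1 := ht2.closed hd hr1.1
      have e2 := ht2.closed hd hr1.2.2
      ext z; simp only [Set.mem_insert_iff, Set.mem_singleton_iff]; grind
    · have e1 := ht3.closed hd hr1.1
      have e2 := ht3.closed hd hr1.2.2
      ext z; simp only [Set.mem_insert_iff, Set.mem_singleton_iff]; grind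
  have mem : ∀ r, (r = a ∨ r = b ∨ r = c) →
      (r ∈ {t | ∃ a b, Tri H m a b t ∧ f {a, b, t} = t} ↔ f {a, b, c} = r) := by
    intro r hr
    constructor
    · rintro ⟨p, q, h, h'⟩
      rw [← hset p q r h hr]; exact h'
    · intro h'
      rcases hr with rfl | rfl | rfl
      · exact ⟨_, _, ht.rot hm, by rw [hset _ _ _ (ht.rot hm) (by simp)]; exact h'⟩
      · exact ⟨_, _, (ht.rot hm).rot hm, by rw [hset _ _ _ ((ht.rot hm).rot hm) (by simp)]; exact h'⟩
      · exact ⟨_, _, ht, h'⟩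
  rw [mem a (by simp), mem b (by simp), mem c (by simp)]
  have := hf _ a b c rfl ht
  have n1 := ht.1.ne'
  have n2 := ht.2.1.ne'
  have n3 := ht.2.2.ne'
  grind

open Classical in
/-- the colouring: matching edges and triangle edges opposite the apex get colour 1 -/
noncomputable def colr (H : SimpleGraph V) (m : V → V) (A : Set V) (e : Sym2 V) : ℕ :=
  if ∃ v w, e = s(v, w) ∧ (w = m v ∨ (v ∉ A ∧ w ∉ A ∧ ∃ t, Tri H m v w t)) then 1 else 0

theorem colr_m {A : Set V} {v w : V} (h : w = m v) : colr H m A s(v, w) = 1 := by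
  unfold colr
  rw [if_pos]
  exact ⟨v, w, rfl, Or.inl h⟩

theorem colr_special {A : Set V} {v w t : V} (hv : v ∉ A) (hw : w ∉ A) (ht : Tri H m v w t) :
    colr H m A s(v, w) = 1 := by
  unfold colr
  rw [if_pos]
  exact ⟨v, w, rfl, Or.inr ⟨hv, hw, t, ht⟩⟩

theorem colr_zero (hm : ∀ v, m (m v) = v) {A : Set V} {v w : V} (h : Rad H m v w)
    (hA : (∀ t, ¬ Tri H m v w t) ∨ v ∈ A ∨ w ∈ A) :
    colr H m A s(v, w) = 0 := by
  unfold colr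
  rw [if_neg]
  rintro ⟨p, q, he, hh⟩
  have h2 := h.symm' hm
  rw [Sym2.eq_iff] at he
  rcases he with ⟨rfl, rfl⟩ | ⟨rfl, rfl⟩
  · rcases hh with hh | ⟨h3, h4, t, h5⟩
    · exact h.2 hh
    · have := fun z : (∀ t, ¬ Tri H m v w t) => z t h5
      tauto
  · rcases hh with hh | ⟨h3, h4, t, h5⟩
    · exact h2.2 hh
    · have := fun z : (∀ t, ¬ Tri H m v w t) => z t (h5.swap hm)
      tauto

theorem colr_lt {A : Set V} (e : Sym2 V) : colr H m A e < 2 := by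
  unfold colr
  split_ifs <;> simp

theorem proper_of_clean (hm : ∀ v, m (m v) = v) {A Z : Set V} (hZ : Clean H m Z) :
    ProperSet H (colr H m A) Z := by
  intro v w₁ w₂ a1 a2 hne n1 n2
  by_cases e1 : w₁ = m v
  · have e2 : w₂ ≠ m v := by rintro rfl; exact hne e1
    rw [colr_m e1, colr_zero hm ⟨a2, e2⟩ (Or.inl (hZ.2 _ _ ⟨a2, e2⟩ n2))]
    simp
  · by_cases e2 : w₂ = m v
    · rw [colr_m e2, colr_zero hm ⟨a1, e1⟩ (Or.inl (hZ.2 _ _ ⟨a1, e1⟩ n1))]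
      simp
    · exact absurd (hZ.1 _ _ _ ⟨a1, e1⟩ ⟨a2, e2⟩ n1 n2) hne

theorem proper_tri (hm : ∀ v, m (m v) = v) (hd : Deg2 H m) {A : Set V} {a b c : V}
    (ht : Tri H m a b c) (hc : c ∈ A) (ha : a ∉ A) (hb : b ∉ A) (hbad : ¬ BadPair H m a b) :
    ∃ S, a ∈ S ∧ b ∉ S ∧ c ∉ S ∧ ProperSet H (colr H m A) S := by
  obtain ⟨Z, hZ, hZa, hZb⟩ : ∃ Z, Clean H m Z ∧ (H.Adj a (m a) → m a ∈ Z) ∧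
      (H.Adj b (m b) → m b ∉ Z) := by
    by_cases h1 : H.Adj a (m a)
    · by_cases h2 : H.Adj b (m b)
      · have hne : m a ≠ m b := by
          intro h
          have := congrArg m h
          rw [hm, hm] at this
          exact ht.1.ne' this
        obtain ⟨Z, h3, h4, h5⟩ := exists_clean hm hd hne (fun t h => hbad ⟨h1, h2, t, h⟩)
        exact ⟨Z, h3, fun _ => h4, fun _ => h5⟩
      · exact ⟨Set.univ, clean_univ, by simp, by tauto⟩
    · exact ⟨∅, clean_empty, by tauto, by simp⟩
  have memS : ∀ v, v ∈ (Z \ {a, b, c}) ∪ {a} ↔ (v = a ∨ (v ∈ Z ∧ v ≠ b ∧ v ≠ c)) := by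
    intro v
    simp only [Set.mem_union, Set.mem_sdiff, Set.mem_insert_iff, Set.mem_singleton_iff]
    by_cases h : v = a <;> simp [h]
  have ca : ∀ w, Rad H m a w → w = b ∨ w = c := fun w hw => ht.closed hd hw
  have cb : ∀ w, Rad H m b w → w = c ∨ w = a := fun w hw => (ht.rot hm).closed hd hw
  have cc : ∀ w, Rad H m c w → w = a ∨ w = b := fun w hw => ((ht.rot hm).rot hm).closed hd hw
  have nab := ht.1.ne'
  have nbc := ht.2.1.ne'
  have nac := ht.2.2.ne'
  have mab := ht.1.2
  have mbc := ht.2.1.2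
  have mac := ht.2.2.2
  have mba := (ht.1.symm' hm).2
  have mcb := (ht.2.1.symm' hm).2
  have mca := (ht.2.2.symm' hm).2
  have kab : colr H m A s(a, b) = 1 := colr_special ha hb ht
  have kac : colr H m A s(a, c) = 0 := colr_zero hm ht.2.2 (by tauto)
  have kca : colr H m A s(c, a) = 0 := by rw [Sym2.eq_swap]; exact kac
  have kba : colr H m A s(b, a) = 1 := by rw [Sym2.eq_swap]; exact kab
  refine ⟨(Z \ {a, b, c}) ∪ {a}, by rw [memS]; simp,
    by rw [memS]; simp [nab.symm], by rw [memS]; simp [nac.symm], ?_⟩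
  intro v w₁ w₂ a1 a2 hne n1 n2
  rw [memS, memS] at n1 n2
  by_cases va : v = a
  · subst va
    have key : ∀ w, H.Adj v w → ¬ ((v = v ∨ (v ∈ Z ∧ v ≠ b ∧ v ≠ c)) ↔ (w = v ∨ (w ∈ Z ∧ w ≠ b ∧ w ≠ c))) →
        w = b ∨ w = c := by
      intro w h1 h2
      by_cases hw : w = m v
      · subst hw
        exact (h2 ⟨fun _ => Or.inr ⟨hZa h1, Ne.symm mab, Ne.symm mac⟩, fun _ => Or.inl rfl⟩).elim
      · exact ca w ⟨h1, hw⟩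
    rcases key _ a1 n1 with rfl | rfl <;> rcases key _ a2 n2 with rfl | rfl
    · exact absurd rfl hne
    · rw [kab, kac]; simp
    · rw [kab, kac]; simp
    · exact absurd rfl hne
  by_cases vb : v = b
  · subst vb
    have key : ∀ w, H.Adj v w → ¬ ((v = a ∨ (v ∈ Z ∧ v ≠ v ∧ v ≠ c)) ↔ (w = a ∨ (w ∈ Z ∧ w ≠ v ∧ w ≠ c))) →
        w = a := by
      intro w h1 h2
      by_cases hw : w = m v
      · subst hw
        exact (h2 ⟨by simp [va], by simp [mba.symm, hZb h1]⟩).elim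
      · rcases cb w ⟨h1, hw⟩ with rfl | rfl
        · exact (h2 (by simp [va, nac.symm])).elim
        · rfl
    exact absurd ((key _ a1 n1).trans (key _ a2 n2).symm) hne
  by_cases vc : v = c
  · subst vc
    have key : ∀ w, H.Adj v w → ¬ ((v = a ∨ (v ∈ Z ∧ v ≠ b ∧ v ≠ v)) ↔ (w = a ∨ (w ∈ Z ∧ w ≠ b ∧ w ≠ v))) →
        w = a ∨ w = m v := by
      intro w h1 h2
      by_cases hw : w = m v
      · exact Or.inr hw
      · rcases cc w ⟨h1, hw⟩ with rfl | rfl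
        · left; rfl
        · exact (h2 (by simp [va, nab.symm])).elim
    rcases key _ a1 n1 with e1 | e1 <;> rcases key _ a2 n2 with e2 | e2
    · exact absurd (e1.trans e2.symm) hne
    · rw [colr_m e2, e1, kca]; simp
    · rw [colr_m e1, e2, kca]; simp
    · exact absurd (e1.trans e2.symm) hne
  have hout : ∀ w, Rad H m v w → w ≠ a ∧ w ≠ b ∧ w ≠ c := by
    intro w hw
    have hw' := hw.symm' hm
    refine ⟨?_, ?_, ?_⟩
    · rintro rfl; rcases ca _ hw' with h | h <;> contradiction
    · rintro rfl; rcases cb _ hw' with h | h <;> contradiction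
    · rintro rfl; rcases cc _ hw' with h | h <;> contradiction
  have hcl : ∀ w, Rad H m v w → ¬ ((v = a ∨ (v ∈ Z ∧ v ≠ b ∧ v ≠ c)) ↔
      (w = a ∨ (w ∈ Z ∧ w ≠ b ∧ w ≠ c))) → ¬ (v ∈ Z ↔ w ∈ Z) := by
    intro w hw n
    obtain ⟨o1, o2, o3⟩ := hout w hw
    simpa [va, vb, vc, o1, o2, o3] using n
  by_cases e1 : w₁ = m v
  · have e2 : w₂ ≠ m v := by rintro rfl; exact hne e1
    rw [colr_m e1, colr_zero hm ⟨a2, e2⟩ (Or.inl (hZ.2 _ _ ⟨a2, e2⟩ (hcl _ ⟨a2, e2⟩ n2)))]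
    simp
  · by_cases e2 : w₂ = m v
    · rw [colr_m e2, colr_zero hm ⟨a1, e1⟩ (Or.inl (hZ.2 _ _ ⟨a1, e1⟩ (hcl _ ⟨a1, e1⟩ n1)))]
      simp
    · exact absurd (hZ.1 _ _ _ ⟨a1, e1⟩ ⟨a2, e2⟩ (hcl _ ⟨a1, e1⟩ n1) (hcl _ ⟨a2, e2⟩ n2)) hne

theorem core_main (hm : ∀ v, m (m v) = v) (hd : Deg2 H m)
    (hP : ∀ a b c, Tri H m a b c → Tri H m (m a) (m b) (m c) →
      H.Adj a (m a) → H.Adj b (m b) → H.Adj c (m c) → False) :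
    ∃ c : Sym2 V → ℕ, (∀ e, c e < 2) ∧ ∀ x y, x ≠ y →
      ∃ S : Set V, ¬ (x ∈ S ↔ y ∈ S) ∧ ProperSet H c S := by
  obtain ⟨A, hA⟩ := exists_apex hm hd hP
  refine ⟨colr H m A, colr_lt, fun x y hxy => ?_⟩
  by_cases hT : ∃ t, Tri H m x y t
  · obtain ⟨t, ht⟩ := hT
    rcases (hA _ _ _ ht).1 with h | h | h
    · have ht' := ht.rot hm
      obtain ⟨h1, h2, h3⟩ := (hA _ _ _ ht').2 h
      obtain ⟨S, s1, s2, s3, s4⟩ := proper_tri hm hd ht' h h1 h2 h3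
      exact ⟨S, by tauto, s4⟩
    · have ht' := (ht.swap hm).rot hm
      obtain ⟨h1, h2, h3⟩ := (hA _ _ _ ht').2 h
      obtain ⟨S, s1, s2, s3, s4⟩ := proper_tri hm hd ht' h h1 h2 h3
      exact ⟨S, by tauto, s4⟩
    · obtain ⟨h1, h2, h3⟩ := (hA _ _ _ ht).2 h
      obtain ⟨S, s1, s2, s3, s4⟩ := proper_tri hm hd ht h h1 h2 h3
      exact ⟨S, by tauto, s4⟩
  · push Not at hT
    obtain ⟨Z, h1, h2, h3⟩ := exists_clean hm hd hxy hT
    exact ⟨Z, by tauto, proper_of_clean hm h1⟩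

end core

section bridges

/-- `G` with all bridges removed -/
def noBr (G : SimpleGraph V) : SimpleGraph V := G.deleteEdges {e | G.IsBridge e}

theorem noBr_adj {G : SimpleGraph V} {v w : V} :
    (noBr G).Adj v w ↔ G.Adj v w ∧ ¬ G.IsBridge s(v, w) := by
  simp [noBr, SimpleGraph.deleteEdges_adj]

theorem not_reachable_of_trail {G : SimpleGraph V} {e : Sym2 V} (he : G.IsBridge e) {x y : V}
    (p : G.Walk x y) (hp : p.IsTrail) (hep : e ∈ p.edges) :
    ¬ (G.deleteEdges {e}).Reachable x y := by
  induction p with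
  | nil => simp at hep
  | @cons a b c h q ih =>
    rw [SimpleGraph.Walk.isTrail_cons] at hp
    intro hr
    by_cases heq : e = s(a, b)
    · subst heq
      have h1 : (G.deleteEdges {s(a, b)}).Reachable b c :=
        SimpleGraph.reachable_deleteEdges_iff_exists_walk.2 ⟨q, hp.2⟩
      exact SimpleGraph.isBridge_iff.1 he (hr.trans h1.symm)
    · rw [SimpleGraph.Walk.edges_cons, List.mem_cons] at hep
      have hq : e ∈ q.edges := by tauto
      refine ih hp.1 hq (SimpleGraph.Reachable.trans ?_ hr)
      apply SimpleGraph.Adj.reachable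
      rw [SimpleGraph.deleteEdges_adj]
      refine ⟨h.symm, ?_⟩
      rw [Set.mem_singleton_iff, Sym2.eq_swap]
      exact fun h => heq h.symm

theorem sep_of_proper {G : SimpleGraph V} (hG : G.Connected) (c : Sym2 V → ℕ) {x y : V}
    {S : Set V} (hS : ¬ (x ∈ S ↔ y ∈ S)) (hp : ProperSet (noBr G) c S) :
    ∃ F, IsProperSepCut G c F x y := by
  classical
  obtain ⟨p, hpp⟩ := (hG.preconnected x y).exists_isPath
  by_cases hb : ∃ e ∈ p.edges, G.IsBridge e
  · obtain ⟨e, hep, he⟩ := hb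
    refine ⟨{e}, ⟨?_, not_reachable_of_trail he p hpp.isTrail hep⟩, ?_⟩
    · simpa using p.edges_subset_edgeSet hep
    · rintro e₁ rfl e₂ rfl h
      exact absurd rfl h.1
  · push Not at hb
    refine ⟨{e | ∃ v w, e = s(v, w) ∧ (noBr G).Adj v w ∧ v ∈ S ∧ w ∉ S}, ⟨?_, ?_⟩, ?_⟩
    · rintro e ⟨v, w, rfl, h, -⟩
      exact (noBr_adj.1 h).1
    · intro hr
      obtain ⟨q, hq⟩ := hr.exists_isPath
      have key : ∀ (a b : V), (∃ q : (G.deleteEdges {e | ∃ v w, e = s(v, w) ∧ (noBr G).Adj v w ∧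
          v ∈ S ∧ w ∉ S}).Walk a b, ∀ e ∈ q.edges, ¬ G.IsBridge e) → (a ∈ S ↔ b ∈ S) := by
        rintro a b ⟨q, hq⟩
        induction q with
        | nil => exact Iff.rfl
        | @cons a b c h q ih =>
          rw [SimpleGraph.Walk.edges_cons] at hq
          refine Iff.trans ?_ (ih (fun e he => hq e (List.mem_cons_of_mem _ he)))
          rw [SimpleGraph.deleteEdges_adj] at h
          have h1 : (noBr G).Adj a b := noBr_adj.2 ⟨h.1, hq _ List.mem_cons_self⟩
          by_contra hne
          apply h.2
          by_cases ha : a ∈ S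
          · exact ⟨a, b, rfl, h1, ha, by tauto⟩
          · exact ⟨b, a, Sym2.eq_swap, h1.symm, by tauto, ha⟩
      refine hS (key x y ⟨q, ?_⟩)
      intro e heq hbr
      have hle : G.deleteEdges {e | ∃ v w, e = s(v, w) ∧ (noBr G).Adj v w ∧ v ∈ S ∧ w ∉ S} ≤ G :=
        SimpleGraph.deleteEdges_le _
      have ht := not_reachable_of_trail hbr (q.mapLe hle)
        (SimpleGraph.Walk.IsTrail.mapLe hle hq.isTrail) (by simpa using heq)
      apply ht
      revert hbr hb ht heq
      induction e with
      | _ u v =>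
        intro hb heq hbr _
        exact SimpleGraph.reachable_deleteEdges_iff_exists_walk.2 ⟨p, fun h => hb _ h hbr⟩
    · rintro e₁ ⟨v₁, w₁, rfl, h1, hv1, hw1⟩ e₂ ⟨v₂, w₂, rfl, h2, hv2, hw2⟩ ⟨hne, t, ht1, ht2⟩
      rw [Sym2.mem_iff] at ht1 ht2
      rcases ht1 with rfl | rfl <;> rcases ht2 with rfl | rfl
      · refine hp _ _ _ h1 h2 (by rintro rfl; exact hne rfl) (by tauto) (by tauto)
      · exact absurd hv1 hw2
      · exact absurd hv2 hw1
      · rw [Sym2.eq_swap, Sym2.eq_swap (a := v₂)]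
        refine hp _ _ _ h1.symm h2.symm (by rintro rfl; exact hne rfl) (by tauto) (by tauto)

end bridges

section petersen

open Finset in
theorem odd_boundary [Fintype V] [DecidableEq V] (G : SimpleGraph V) [DecidableRel G.Adj]
    (hreg : G.IsRegularOfDegree 3) (X u : Finset V) (hdis : Disjoint X u)
    (hcl : ∀ v ∈ X, ∀ w, G.Adj v w → w ∈ u ∨ w ∈ X)
    (hbr : ∀ v ∈ X, ∀ w, G.Adj v w → ¬ G.IsBridge s(v, w)) (hodd : Odd #X) :
    3 ≤ #{p ∈ X ×ˢ u | G.Adj p.1 p.2} := by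
  have hsum : #{p ∈ X ×ˢ u | G.Adj p.1 p.2} = ∑ v ∈ X, #{w ∈ u | G.Adj v w} := by
    simp only [Finset.card_filter]
    rw [Finset.sum_product]
  let G' : SimpleGraph V :=
    { Adj := fun v w => G.Adj v w ∧ v ∈ X ∧ w ∈ X
      symm := ⟨fun v w h => ⟨h.1.symm, h.2.2, h.2.1⟩⟩
      loopless := ⟨fun v h => G.loopless.irrefl v h.1⟩ }
  have hdeg : ∀ v ∈ X, #{w ∈ u | G.Adj v w} + #{w ∈ X | G.Adj v w} = 3 := by
    intro v hv
    rw [← hreg v, ← SimpleGraph.card_neighborFinset_eq_degree, ← Finset.card_union_of_disjoint]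
    · congr 1
      ext w
      simp only [mem_union, mem_filter, SimpleGraph.mem_neighborFinset]
      have := hcl v hv w
      tauto
    · exact Finset.disjoint_filter_filter hdis.symm
  have heven : Even (∑ v ∈ X, #{w ∈ X | G.Adj v w}) := by
    classical
    have h1 : ∑ v ∈ X, #{w ∈ X | G.Adj v w} = ∑ v, G'.degree v := by
      rw [← Finset.sum_subset (Finset.subset_univ X)]
      · apply Finset.sum_congr rfl
        intro v hv
        rw [← SimpleGraph.card_neighborFinset_eq_degree]
        congr 1
        ext w
        simp [G', hv, and_comm]
      · intro v _ hv
        rw [← SimpleGraph.card_neighborFinset_eq_degree, Finset.card_eq_zero]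
        ext w
        simp [G', hv]
    rw [h1, SimpleGraph.sum_degrees_eq_twice_card_edges]
    exact even_two_mul _
  have htot : ∑ v ∈ X, #{w ∈ u | G.Adj v w} + ∑ v ∈ X, #{w ∈ X | G.Adj v w} = #X * 3 := by
    rw [← Finset.sum_add_distrib, Finset.sum_congr rfl hdeg]
    simp
  have hoddE : Odd #{p ∈ X ×ˢ u | G.Adj p.1 p.2} := by
    rw [hsum]
    have : Odd (#X * 3) := hodd.mul (by decide)
    rw [← htot] at this
    exact (Nat.odd_add.1 this).2 heven
  by_contra hlt
  have h1 : #{p ∈ X ×ˢ u | G.Adj p.1 p.2} = 1 := by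
    obtain ⟨k, hk⟩ := hoddE
    omega
  obtain ⟨⟨v, w⟩, hvw⟩ := Finset.card_eq_one.1 h1
  have hmem : (v, w) ∈ ({p ∈ X ×ˢ u | G.Adj p.1 p.2} : Finset (V × V)) := by rw [hvw]; simp
  simp only [mem_filter, mem_product] at hmem
  obtain ⟨⟨hv, hw⟩, hadj⟩ := hmem
  have hnb := hbr v hv w hadj
  rw [SimpleGraph.isBridge_iff, not_not] at hnb
  obtain ⟨p⟩ := hnb
  obtain ⟨d, -, hd1, hd2⟩ := p.exists_boundary_dart (X : Set V) (by simpa using hv)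
    (by simpa using Finset.disjoint_right.1 hdis hw)
  have hd := d.adj
  rw [SimpleGraph.deleteEdges_adj] at hd
  simp only [mem_coe] at hd1 hd2
  have hdu : d.snd ∈ u := (hcl _ hd1 _ hd.1).resolve_right hd2
  have : (d.fst, d.snd) ∈ ({p ∈ X ×ˢ u | G.Adj p.1 p.2} : Finset (V × V)) := by
    simp [hd1, hdu, hd.1]
  rw [hvw, mem_singleton, Prod.mk.injEq] at this
  apply hd.2
  rw [this.1, this.2]
  rfl

/-- vertices incident with a bridge -/
def Dset (G : SimpleGraph V) : Set V := {v | ∃ w, G.Adj v w ∧ G.IsBridge s(v, w)}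

/-- auxiliary graph -/
def plusG (G : SimpleGraph V) : SimpleGraph V where
  Adj v w := v ≠ w ∧ ((noBr G).Adj v w ∨ (v ∈ Dset G ∧ w ∈ Dset G))
  symm := ⟨fun v w h => ⟨h.1.symm, h.2.imp (fun h => h.symm) (fun h => h.symm)⟩⟩
  loopless := ⟨fun v h => h.1 rfl⟩

open Finset in
theorem no_violator [Fintype V] (G : SimpleGraph V) [DecidableRel G.Adj]
    (hreg : G.IsRegularOfDegree 3) (u : Set V) : ¬ (plusG G).IsTutteViolator u := by
  classical
  intro hu
  unfold SimpleGraph.IsTutteViolator at hu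
  set K := ((⊤ : (plusG G).Subgraph).deleteVerts u).coe with hK
  have hverts : ∀ v, v ∈ ((⊤ : (plusG G).Subgraph).deleteVerts u).verts ↔ v ∉ u := by
    intro v; simp
  have hVeven : Even (Fintype.card V) := by
    have h := G.sum_degrees_eq_twice_card_edges
    rw [Finset.sum_congr rfl (fun v _ => hreg v)] at h
    simp only [sum_const, card_univ, smul_eq_mul] at h
    rw [Nat.even_iff]; omega
  have hcardV : Nat.card ((⊤ : (plusG G).Subgraph).deleteVerts u).verts + u.ncard
      = Fintype.card V := by
    have h1 : ((⊤ : (plusG G).Subgraph).deleteVerts u).verts = uᶜ := by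
      ext v; rw [hverts]; rfl
    rw [h1, Nat.card_coe_set_eq, add_comm, Set.ncard_add_ncard_compl, Nat.card_eq_fintype_card]
  have hpar := K.odd_ncard_oddComponents
  let s : K.ConnectedComponent → Finset V := fun C =>
    univ.filter (fun v => ∃ h : v ∉ u, K.connectedComponentMk ⟨v, (hverts v).2 h⟩ = C)
  have hs : ∀ C v, v ∈ s C ↔ ∃ h : v ∉ u, K.connectedComponentMk ⟨v, (hverts v).2 h⟩ = C := by
    intro C v; simp [s]
  have hKadj : ∀ v w (hv : v ∉ u) (hw : w ∉ u), (plusG G).Adj v w →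
      K.connectedComponentMk ⟨v, (hverts v).2 hv⟩ = K.connectedComponentMk ⟨w, (hverts w).2 hw⟩ := by
    intro v w hv hw h
    apply SimpleGraph.ConnectedComponent.sound
    apply SimpleGraph.Adj.reachable
    simp [hK, hv, hw, h]
  have hscard : ∀ C, #(s C) = C.supp.ncard := by
    intro C
    have : ((s C : Finset V) : Set V) = Subtype.val '' C.supp := by
      ext v
      simp only [mem_coe, hs, Set.mem_image, SimpleGraph.ConnectedComponent.mem_supp_iff]
      constructor
      · rintro ⟨h, h'⟩
        exact ⟨_, h', rfl⟩
      · rintro ⟨⟨w, hw⟩, h', rfl⟩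
        exact ⟨(hverts w).1 hw, h'⟩
    rw [← Set.ncard_coe_finset, this, Set.ncard_image_of_injective _ Subtype.val_injective]
  let O : Finset K.ConnectedComponent := K.oddComponents.toFinset
  have hO : #O = K.oddComponents.ncard := by
    simp only [O, Set.ncard_eq_toFinset_card']
  let O' := O.filter (fun C => ∀ v ∈ s C, v ∉ Dset G)
  have hO' : #O ≤ #O' + 1 := by
    rw [← Finset.card_filter_add_card_filter_not (s := O) (fun C => ∀ v ∈ s C, v ∉ Dset G)]
    apply Nat.add_le_add_left
    rw [Finset.card_le_one]
    intro C hC C' hC'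
    simp only [mem_filter, not_forall, not_not] at hC hC'
    obtain ⟨-, v, hv, hvD⟩ := hC
    obtain ⟨-, w, hw, hwD⟩ := hC'
    obtain ⟨hvu, rfl⟩ := (hs _ _).1 hv
    obtain ⟨hwu, rfl⟩ := (hs _ _).1 hw
    by_cases hvw : v = w
    · subst hvw; rfl
    · exact hKadj v w hvu hwu ⟨hvw, Or.inr ⟨hvD, hwD⟩⟩
  have hge : ∀ C ∈ O', 3 ≤ #{p ∈ s C ×ˢ u.toFinset | G.Adj p.1 p.2} := by
    intro C hC
    simp only [O', O, mem_filter, Set.mem_toFinset] at hC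
    have hnb : ∀ v ∈ s C, ∀ w, G.Adj v w → ¬ G.IsBridge s(v, w) :=
      fun v hv w hw hb => hC.2 v hv ⟨w, hw, hb⟩
    apply odd_boundary G hreg _ _ _ _ hnb
    · rw [hscard]; exact hC.1
    · rw [Finset.disjoint_left]
      intro v hv hvu
      obtain ⟨h, -⟩ := (hs _ _).1 hv
      exact h (by simpa using hvu)
    · intro v hv w hw
      by_cases hwu : w ∈ u
      · left; simpa using hwu
      · right
        have hnb' := hnb v hv w hw
        obtain ⟨hvu, rfl⟩ := (hs _ _).1 hv
        refine (hs _ _).2 ⟨hwu, (hKadj v w hvu hwu ⟨hw.ne, Or.inl (noBr_adj.2 ⟨hw, hnb'⟩)⟩).symm⟩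
  have hle : ∑ C ∈ O', #{p ∈ s C ×ˢ u.toFinset | G.Adj p.1 p.2} ≤ 3 * u.ncard := by
    rw [← Finset.card_biUnion]
    · calc _ ≤ #{p ∈ (univ : Finset V) ×ˢ u.toFinset | G.Adj p.1 p.2} := by
            apply Finset.card_le_card
            intro p hp
            simp only [mem_biUnion, mem_filter, mem_product] at hp ⊢
            obtain ⟨C, -, h⟩ := hp
            exact ⟨⟨mem_univ _, h.1.2⟩, h.2⟩
        _ = ∑ w ∈ u.toFinset, G.degree w := by
            simp only [Finset.card_filter]
            rw [Finset.sum_product_right]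
            apply Finset.sum_congr rfl
            intro w _
            rw [← Finset.card_filter, ← SimpleGraph.card_neighborFinset_eq_degree]
            congr 1
            ext v
            simp [SimpleGraph.adj_comm]
        _ = 3 * u.ncard := by
            rw [Finset.sum_congr rfl (fun v _ => hreg v), Set.ncard_eq_toFinset_card']
            simp [mul_comm]
    · intro C _ C' _ hne
      change Disjoint _ _
      rw [Finset.disjoint_left]
      rintro ⟨v, w⟩ h1 h2
      simp only [mem_filter, mem_product] at h1 h2
      obtain ⟨_, e1⟩ := (hs _ _).1 h1.1.1
      obtain ⟨_, e2⟩ := (hs _ _).1 h2.1.1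
      exact hne (e1.symm.trans e2)
  have hge' : #O' * 3 ≤ ∑ C ∈ O', #{p ∈ s C ×ˢ u.toFinset | G.Adj p.1 p.2} := by
    have := Finset.card_nsmul_le_sum O' _ 3 hge
    simpa using this
  rw [← hO] at hu hpar
  rw [Nat.odd_iff, Nat.odd_iff] at hpar
  rw [Nat.even_iff] at hVeven
  omega

theorem exists_m [Fintype V] (G : SimpleGraph V) [DecidableRel G.Adj]
    (hreg : G.IsRegularOfDegree 3) :
    ∃ m : V → V, (∀ v, m (m v) = v) ∧
      ∀ v, (∀ w, G.Adj v w → (noBr G).Adj v w) → (noBr G).Adj v (m v) := by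
  obtain ⟨M, hM⟩ := SimpleGraph.tutte.2 (no_violator G hreg)
  rw [SimpleGraph.Subgraph.isPerfectMatching_iff] at hM
  choose m hm hm' using hM
  refine ⟨m, fun v => (hm' _ _ (hm v).symm).symm, fun v hv => ?_⟩
  have := (hm v).adj_sub
  rcases this.2 with h | ⟨⟨w, h1, h2⟩, -⟩
  · exact h
  · exact absurd h2 (noBr_adj.1 (hv w h1)).2

end petersen

section final

theorem nbr_of_three [Fintype V] (G : SimpleGraph V) [DecidableRel G.Adj]
    (hreg : G.IsRegularOfDegree 3) {v w₁ w₂ w₃ : V} (h1 : G.Adj v w₁) (h2 : G.Adj v w₂)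
    (h3 : G.Adj v w₃) (h12 : w₁ ≠ w₂) (h13 : w₁ ≠ w₃) (h23 : w₂ ≠ w₃) (w : V) (hw : G.Adj v w) :
    w = w₁ ∨ w = w₂ ∨ w = w₃ := by
  classical
  have hsub : ({w₁, w₂, w₃} : Finset V) ⊆ G.neighborFinset v := by
    intro x hx
    simp only [Finset.mem_insert, Finset.mem_singleton] at hx
    rw [SimpleGraph.mem_neighborFinset]
    rcases hx with rfl | rfl | rfl <;> assumption
  have hcard : (G.neighborFinset v).card ≤ ({w₁, w₂, w₃} : Finset V).card := by
    rw [SimpleGraph.card_neighborFinset_eq_degree, hreg v,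
      Finset.card_eq_three.2 ⟨w₁, w₂, w₃, h12, h13, h23, rfl⟩]
  have heq := Finset.eq_of_subset_of_card_le hsub hcard
  have : w ∈ ({w₁, w₂, w₃} : Finset V) := by
    rw [heq, SimpleGraph.mem_neighborFinset]; exact hw
  simpa using this

theorem deg2_noBr [Fintype V] (G : SimpleGraph V) [DecidableRel G.Adj]
    (hreg : G.IsRegularOfDegree 3) {m : V → V}
    (hm' : ∀ v, (∀ w, G.Adj v w → (noBr G).Adj v w) → (noBr G).Adj v (m v)) :
    Deg2 (noBr G) m := by
  intro v w₁ w₂ w₃ h1 h2 h3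
  by_contra hne
  push Not at hne
  have key := nbr_of_three G hreg (noBr_adj.1 h1.1).1 (noBr_adj.1 h2.1).1 (noBr_adj.1 h3.1).1
    hne.1 hne.2.1 hne.2.2
  have hmv := hm' v (fun w hw => by
    rcases key w hw with rfl | rfl | rfl
    · exact h1.1
    · exact h2.1
    · exact h3.1)
  rcases key _ (noBr_adj.1 hmv).1 with h | h | h
  · exact h1.2 h.symm
  · exact h2.2 h.symm
  · exact h3.2 h.symm

theorem prism_cut (H : SimpleGraph V) (col : Sym2 V → ℕ) {a b c a' b' c' : V}
    (na : ∀ w, H.Adj a w → w = b ∨ w = c ∨ w = a')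
    (na' : ∀ w, H.Adj a' w → w = b' ∨ w = c' ∨ w = a)
    (hb : ∀ w, H.Adj b w → w ≠ a') (hc : ∀ w, H.Adj c w → w ≠ a')
    (hb' : ∀ w, H.Adj b' w → w ≠ a) (hc' : ∀ w, H.Adj c' w → w ≠ a)
    (h1 : col s(a, b) ≠ col s(a, c)) (h2 : col s(a', b') ≠ col s(a', c')) :
    ProperSet H col {a, a'} := by
  have key : ∀ v w₁ w₂, H.Adj v w₁ → H.Adj v w₂ → w₁ ≠ w₂ → (v = a ∨ v = a') →
      ¬ (w₁ = a ∨ w₁ = a') → ¬ (w₂ = a ∨ w₂ = a') → col s(v, w₁) ≠ col s(v, w₂) := by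
    intro v w₁ w₂ e1 e2 hne hv n1 n2
    push Not at n1 n2
    rcases hv with rfl | rfl
    · have k1 := na _ e1
      have k2 := na _ e2
      rcases k1 with rfl | rfl | rfl <;> rcases k2 with rfl | rfl | rfl <;>
        first | exact h1 | exact h1.symm | exact absurd rfl hne | exact absurd rfl n1.2 | exact absurd rfl n2.2
    · have k1 := na' _ e1
      have k2 := na' _ e2
      rcases k1 with rfl | rfl | rfl <;> rcases k2 with rfl | rfl | rfl <;>
        first | exact h2 | exact h2.symm | exact absurd rfl hne | exact absurd rfl n1.1 | exact absurd rfl n2.1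
  intro v w₁ w₂ e1 e2 hne n1 n2
  simp only [Set.mem_insert_iff, Set.mem_singleton_iff] at n1 n2
  by_cases hv : v = a ∨ v = a'
  · exact key v w₁ w₂ e1 e2 hne hv (by tauto) (by tauto)
  · exfalso
    have k1 : w₁ = a ∨ w₁ = a' := by tauto
    have k2 : w₂ = a ∨ w₂ = a' := by tauto
    have main : H.Adj v a → H.Adj v a' → False := by
      intro f1 f2
      rcases na _ f1.symm with rfl | rfl | rfl
      · exact hb _ f2 rfl
      · exact hc _ f2 rfl
      · exact hv (Or.inr rfl)
    rcases k1 with rfl | rfl <;> rcases k2 with rfl | rfl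
    · exact hne rfl
    · exact main e1 e2
    · exact main e2 e1
    · exact hne rfl

set_option maxHeartbeats 2000000 in
theorem prism_case [Fintype V] (G : SimpleGraph V) [DecidableRel G.Adj]
    (hconn : G.Connected) (hreg : G.IsRegularOfDegree 3) {m : V → V} (hm : ∀ v, m (m v) = v)
    {a b c : V} (ht : Tri (noBr G) m a b c) (ht' : Tri (noBr G) m (m a) (m b) (m c))
    (haa : (noBr G).Adj a (m a)) (hbb : (noBr G).Adj b (m b)) (hcc : (noBr G).Adj c (m c)) :
    ∃ c : Sym2 V → ℕ, (∀ e, c e < 2) ∧ ∀ x y, x ≠ y →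
      ∃ S : Set V, ¬ (x ∈ S ↔ y ∈ S) ∧ ProperSet (noBr G) c S := by
  classical
  have ab : a ≠ b := ht.1.ne'
  have bc : b ≠ c := ht.2.1.ne'
  have ac : a ≠ c := ht.2.2.ne'
  have ab' : m a ≠ m b := ht'.1.ne'
  have bc' : m b ≠ m c := ht'.2.1.ne'
  have ac' : m a ≠ m c := ht'.2.2.ne'
  have a_b' : b ≠ m a := ht.1.2
  have a_c' : c ≠ m a := ht.2.2.2
  have b_c' : c ≠ m b := ht.2.1.2
  have b_a' : a ≠ m b := (ht.1.symm' hm).2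
  have c_a' : a ≠ m c := (ht.2.2.symm' hm).2
  have c_b' : b ≠ m c := (ht.2.1.symm' hm).2
  have aa : a ≠ m a := haa.ne
  have bb : b ≠ m b := hbb.ne
  have cc : c ≠ m c := hcc.ne
  have le : ∀ {v w}, (noBr G).Adj v w → G.Adj v w := fun h => (noBr_adj.1 h).1
  have na := nbr_of_three G hreg (le ht.1.1) (le ht.2.2.1) (le haa) bc a_b' a_c'
  have nb := nbr_of_three G hreg (le ht.1.1).symm (le ht.2.1.1) (le hbb) ac b_a' b_c'
  have nc := nbr_of_three G hreg (le ht.2.2.1).symm (le ht.2.1.1).symm (le hcc) ab c_a' c_b'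
  have na' := nbr_of_three G hreg (le ht'.1.1) (le ht'.2.2.1) (le haa).symm bc' b_a'.symm c_a'.symm
  have nb' := nbr_of_three G hreg (le ht'.1.1).symm (le ht'.2.1.1) (le hbb).symm ac' a_b'.symm c_b'.symm
  have nc' := nbr_of_three G hreg (le ht'.2.2.1).symm (le ht'.2.1.1).symm (le hcc).symm ab'
    a_c'.symm b_c'.symm
  generalize m a = a' at *
  generalize m b = b' at *
  generalize m c = c' at *
  have huniv : ∀ v, v = a ∨ v = b ∨ v = c ∨ v = a' ∨ v = b' ∨ v = c' := by
    intro v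
    obtain ⟨p⟩ := hconn.preconnected a v
    by_contra hv
    obtain ⟨d, -, hd1, hd2⟩ := p.exists_boundary_dart
      {v | v = a ∨ v = b ∨ v = c ∨ v = a' ∨ v = b' ∨ v = c'} (Or.inl rfl) hv
    have hd := d.adj
    simp only [Set.mem_ofPred_eq] at hd1 hd2
    generalize d.fst = f at *
    generalize d.snd = g at *
    apply hd2
    rcases hd1 with rfl | rfl | rfl | rfl | rfl | rfl
    · have := na _ hd; tauto
    · have := nb _ hd; tauto
    · have := nc _ hd; tauto
    · have := na' _ hd; tauto
    · have := nb' _ hd; tauto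
    · have := nc' _ hd; tauto
  let col : Sym2 V → ℕ := fun e => if e = s(a, b) ∨ e = s(a', b') then 1 else 0
  have k1 : col s(a, b) = 1 := by simp [col]
  have k2 : col s(a', b') = 1 := by simp [col]
  have k3 : col s(a, c) = 0 := by simp [col, bc.symm, b_c', ac.symm, a_c']
  have k4 : col s(b, c) = 0 := by simp [col]; grind
  have k5 : col s(a', c') = 0 := by simp [col]; grind
  have k6 : col s(b', c') = 0 := by simp [col]; grind
  have k1' : col s(b, a) = 1 := by rw [Sym2.eq_swap]; exact k1
  have k2' : col s(b', a') = 1 := by rw [Sym2.eq_swap]; exact k2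
  have P1 : ProperSet (noBr G) col {a, a'} := by
    apply prism_cut (b := b) (c := c) (b' := b') (c' := c')
    · exact fun w h => na w (le h)
    · exact fun w h => na' w (le h)
    · intro w h; have := nb w (le h); grind
    · intro w h; have := nc w (le h); grind
    · intro w h; have := nb' w (le h); grind
    · intro w h; have := nc' w (le h); grind
    · rw [k1, k3]; simp
    · rw [k2, k5]; simp
  have P2 : ProperSet (noBr G) col {b, b'} := by
    apply prism_cut (b := a) (c := c) (b' := a') (c' := c')
    · exact fun w h => nb w (le h)
    · exact fun w h => nb' w (le h)
    · intro w h; have := na w (le h); grind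
    · intro w h; have := nc w (le h); grind
    · intro w h; have := na' w (le h); grind
    · intro w h; have := nc' w (le h); grind
    · rw [k1', k4]; simp
    · rw [k2', k6]; simp
  have P3 : ProperSet (noBr G) col {a, b, c} := by
    intro v w₁ w₂ e1 e2 hne n1 n2
    exfalso
    simp only [Set.mem_insert_iff, Set.mem_singleton_iff] at n1 n2
    rcases huniv v with rfl | rfl | rfl | rfl | rfl | rfl
    · have q1 := na _ (le e1); have q2 := na _ (le e2); clear na nb nc na' nb' nc' huniv; grind
    · have q1 := nb _ (le e1); have q2 := nb _ (le e2); clear na nb nc na' nb' nc' huniv; grind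
    · have q1 := nc _ (le e1); have q2 := nc _ (le e2); clear na nb nc na' nb' nc' huniv; grind
    · have q1 := na' _ (le e1); have q2 := na' _ (le e2); clear na nb nc na' nb' nc' huniv; grind
    · have q1 := nb' _ (le e1); have q2 := nb' _ (le e2); clear na nb nc na' nb' nc' huniv; grind
    · have q1 := nc' _ (le e1); have q2 := nc' _ (le e2); clear na nb nc na' nb' nc' huniv; grind
  refine ⟨col, fun e => by simp only [col]; split_ifs <;> simp, fun x y hxy => ?_⟩
  by_contra hcon
  have f1 : x ∈ ({a, a'} : Set V) ↔ y ∈ ({a, a'} : Set V) := by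
    by_contra h; exact hcon ⟨_, h, P1⟩
  have f2 : x ∈ ({b, b'} : Set V) ↔ y ∈ ({b, b'} : Set V) := by
    by_contra h; exact hcon ⟨_, h, P2⟩
  have f3 : x ∈ ({a, b, c} : Set V) ↔ y ∈ ({a, b, c} : Set V) := by
    by_contra h; exact hcon ⟨_, h, P3⟩
  simp only [Set.mem_insert_iff, Set.mem_singleton_iff] at f1 f2 f3
  have hx := huniv x
  have hy := huniv y
  clear na nb nc na' nb' nc' huniv P1 P2 P3 hcon k1 k2 k3 k4 k5 k6 k1' k2'
  rcases hx with rfl | rfl | rfl | rfl | rfl | rfl <;> grind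

end final

theorem stmt7 {V : Type*} [Fintype V] (G : SimpleGraph V) [DecidableRel G.Adj]
    (hconn : G.Connected) (hreg : G.IsRegularOfDegree 3) (hcard : 4 ≤ Fintype.card V) :
    pd G ≤ 2 := by
  obtain ⟨m, hm, hm'⟩ := exists_m G hreg
  have hd := deg2_noBr G hreg hm'
  obtain ⟨c, hc, hsep⟩ : ∃ c : Sym2 V → ℕ, (∀ e, c e < 2) ∧ ∀ x y, x ≠ y →
      ∃ S : Set V, ¬ (x ∈ S ↔ y ∈ S) ∧ ProperSet (noBr G) c S := by
    by_cases hP : ∃ a b c, Tri (noBr G) m a b c ∧ Tri (noBr G) m (m a) (m b) (m c) ∧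
      (noBr G).Adj a (m a) ∧ (noBr G).Adj b (m b) ∧ (noBr G).Adj c (m c)
    · obtain ⟨a, b, c, h1, h2, h3, h4, h5⟩ := hP
      exact prism_case G hconn hreg hm h1 h2 h3 h4 h5
    · exact core_main hm hd (fun a b c h1 h2 h3 h4 h5 => hP ⟨a, b, c, h1, h2, h3, h4, h5⟩)
  refine Nat.sInf_le ⟨c, fun e _ => hc e, fun x y hxy => ?_⟩
  obtain ⟨S, hS, hp⟩ := hsep x y hxy
  exact sep_of_proper hconn c hS hp
end

section
/- Let G be a connected graph with maximum degree 3 such that the vertices of degree 3 form an independent set, and suppose G contains no triangle and no K_{2,3}. Then for every pair of distinct vertices x, y of G there exists a matching cut separating x and y. -/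
open SimpleGraph

variable {V : Type*}

/-- `G` contains a triangle. -/
def HasTriangle {V : Type*} (G : SimpleGraph V) : Prop :=
  ∃ a b c : V, G.Adj a b ∧ G.Adj b c ∧ G.Adj a c

/-- `G` contains `K_{2,3}` as a subgraph. -/
def HasK23 {V : Type*} (G : SimpleGraph V) : Prop :=
  ∃ f : (Fin 2 ⊕ Fin 3) ↪ V,
    ∀ a b, (completeBipartiteGraph (Fin 2) (Fin 3)).Adj a b → G.Adj (f a) (f b)

/-- Every vertex of `A` has at most one neighbour outside `A`. -/
def SafeSet {V : Type*} (G : SimpleGraph V) (A : Set V) : Prop :=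
  ∀ v ∈ A, ∀ a b, G.Adj v a → G.Adj v b → a ∉ A → b ∉ A → a = b

theorem matchingCut_of_safe {V : Type*} (G : SimpleGraph V) (S : Set V) (x y : V)
    (hx : x ∈ S) (hy : y ∉ S) (h1 : SafeSet G S) (h2 : SafeSet G Sᶜ) :
    ∃ F, IsMatchingSepCut G F x y := by
  refine ⟨{e | ∃ u w, G.Adj u w ∧ u ∈ S ∧ w ∉ S ∧ e = s(u, w)}, ⟨?_, ?_⟩, ?_⟩
  · rintro e ⟨u, w, h, -, -, rfl⟩
    exact h
  · rintro ⟨p⟩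
    have key : ∀ (a b : V), ((G.deleteEdges
        {e | ∃ u w, G.Adj u w ∧ u ∈ S ∧ w ∉ S ∧ e = s(u, w)}).Walk a b) → a ∈ S → b ∈ S := by
      intro a b q
      induction q with
      | nil => exact id
      | cons h q ih =>
        intro ha
        apply ih
        rw [SimpleGraph.deleteEdges_adj] at h
        by_contra hb
        exact h.2 ⟨_, _, h.1, ha, hb, rfl⟩
    exact hy (key _ _ p hx)
  · rintro e₁ ⟨u, w, h, hu, hw, rfl⟩ e₂ ⟨u', w', h', hu', hw', rfl⟩ ⟨hne, v, hv, hv'⟩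
    rw [Sym2.mem_iff] at hv hv'
    rcases hv with rfl | rfl <;> rcases hv' with rfl | rfl
    · exact hne (by rw [h1 _ hu _ _ h h' hw hw'])
    · exact hw' hu
    · exact hw hu'
    · exact hne (by rw [h2 _ hw u u' h.symm h'.symm (fun k => k hu) (fun k => k hu')])

theorem exists_cut_of_disjoint_safe {V : Type*} [Fintype V] (G : SimpleGraph V)
    (h3 : ∀ v a b c d, G.Adj v a → G.Adj v b → G.Adj v c → G.Adj v d →
      a = b ∨ a = c ∨ a = d ∨ b = c ∨ b = d ∨ c = d)
    (A B : Set V) (hA : SafeSet G A) (hB : SafeSet G B) (hAB : ∀ v ∈ A, v ∉ B)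
    (x y : V) (hx : x ∈ A) (hy : y ∈ B) :
    ∃ F, IsMatchingSepCut G F x y := by
  obtain ⟨S, hS⟩ := (Set.toFinite {S : Set V | A ⊆ S ∧ (∀ v ∈ S, v ∉ B) ∧ SafeSet G S}).exists_maximal
    ⟨A, subset_rfl, hAB, hA⟩
  obtain ⟨⟨hAS, hSB, hSS⟩, hmax⟩ := hS
  refine matchingCut_of_safe G S x y (hAS hx) (fun h => hSB y h hy) hSS ?_
  intro v hv a b ha hb haS hbS
  by_contra hab
  simp only [Set.mem_compl_iff, not_not] at hv haS hbS
  have hvB : v ∉ B := fun h => hab (hB v h a b ha hb (hSB a haS) (hSB b hbS))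
  apply hv
  refine hmax (y := insert v S) ⟨hAS.trans (Set.subset_insert _ _), ?_, ?_⟩ (Set.subset_insert _ _)
    (Set.mem_insert _ _)
  · rintro w (rfl | hw)
    · exact hvB
    · exact hSB w hw
  · rintro w (rfl | hw) c d hc hd hcS hdS
    · have := h3 w a b c d ha hb hc hd
      grind
    · exact hSS w hw c d hc hd (fun h => hcS (Or.inr h)) (fun h => hdS (Or.inr h))

theorem two_triples {V : Type*} [DecidableEq V] (P Q : Finset V) (hP : P.card = 3)
    (hQ : Q.card = 3) (hne : P ≠ Q) (x y : V) (hx : x ∈ P) (hy : y ∈ Q) (hxy : x ≠ y) :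
    ∃ p ∈ P, ∃ b ∈ Q, p ≠ x ∧ p ≠ y ∧ b ≠ x ∧ b ≠ y ∧ p ≠ b := by
  have e1 : (P.erase x).card = 2 := by rw [Finset.card_erase_of_mem hx, hP]
  have e2 : (Q.erase y).card = 2 := by rw [Finset.card_erase_of_mem hy, hQ]
  obtain ⟨p, p', hp, hpe⟩ := Finset.card_eq_two.1 e1
  obtain ⟨q, q', hq, hqe⟩ := Finset.card_eq_two.1 e2
  have hP' : P = {x, p, p'} := by rw [← Finset.insert_erase hx, hpe]
  have hQ' : Q = {y, q, q'} := by rw [← Finset.insert_erase hy, hqe]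
  have m1 : ∀ z, z ∈ P ↔ z = x ∨ z = p ∨ z = p' := by simp [hP']
  have m2 : ∀ z, z ∈ Q ↔ z = y ∨ z = q ∨ z = q' := by simp [hQ']
  have n1 : x ≠ p ∧ x ≠ p' := by
    have := Finset.notMem_erase x P
    rw [hpe] at this
    simpa using this
  have n2 : y ≠ q ∧ y ≠ q' := by
    have := Finset.notMem_erase y Q
    rw [hqe] at this
    simpa using this
  by_contra hcon
  push Not at hcon
  apply hne
  ext z
  have c1 := hcon p (by simp [m1]) q (by simp [m2])
  have c2 := hcon p (by simp [m1]) q' (by simp [m2])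
  have c3 := hcon p' (by simp [m1]) q (by simp [m2])
  have c4 := hcon p' (by simp [m1]) q' (by simp [m2])
  rw [m1, m2]
  obtain ⟨n1, n1'⟩ := n1
  obtain ⟨n2, n2'⟩ := n2
  clear hcon m1 m2 hP' hQ' hpe hqe e1 e2 hP hQ hne hx hy
  by_cases hpy : p = y <;> by_cases hpy' : p' = y <;> by_cases hqx : q = x <;>
    by_cases hqx' : q' = x <;> grind

theorem cut_of_centers {V : Type*} [Fintype V] (G : SimpleGraph V) [DecidableRel G.Adj]
    (h3 : ∀ v, G.degree v ≤ 3)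
    (hu3 : ∀ v a b c d, G.Adj v a → G.Adj v b → G.Adj v c → G.Adj v d →
      a = b ∨ a = c ∨ a = d ∨ b = c ∨ b = d ∨ c = d)
    (hu2 : ∀ v a b c, G.degree v ≠ 3 → G.Adj v a → G.Adj v b → G.Adj v c →
      a = b ∨ a = c ∨ b = c)
    (hind : ∀ v w : V, G.degree v = 3 → G.degree w = 3 → ¬ G.Adj v w)
    (hK23 : ¬ HasK23 G) (d e x y : V) (hd : G.degree d = 3) (he : G.degree e = 3) (hde : d ≠ e)
    (hx : G.Adj d x) (hy : G.Adj e y) (hxy : x ≠ y) (x' y' : V) (hx' : x' = d ∨ x' = x)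
    (hy' : y' = e ∨ y' = y) :
    ∃ F, IsMatchingSepCut G F x' y' := by
  classical
  have hne : G.neighborFinset d ≠ G.neighborFinset e := by
    intro h
    apply hK23
    have hc : (G.neighborFinset d).card = 3 := by rw [G.card_neighborFinset_eq_degree, hd]
    obtain ⟨a, b, c, hab, hac, hbc, habc⟩ := Finset.card_eq_three.1 hc
    have m : ∀ z, G.Adj d z ↔ z = a ∨ z = b ∨ z = c := by
      intro z
      rw [← SimpleGraph.mem_neighborFinset, habc]; simp
    have m' : ∀ z, G.Adj e z ↔ z = a ∨ z = b ∨ z = c := by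
      intro z
      rw [← SimpleGraph.mem_neighborFinset, ← h, habc]; simp
    have da : G.Adj d a := (m a).2 (by simp)
    have db : G.Adj d b := (m b).2 (by simp)
    have dc : G.Adj d c := (m c).2 (by simp)
    have ea : G.Adj e a := (m' a).2 (by simp)
    have eb : G.Adj e b := (m' b).2 (by simp)
    have ec : G.Adj e c := (m' c).2 (by simp)
    refine ⟨⟨Sum.elim ![d, e] ![a, b, c], ?_⟩, ?_⟩
    · have := da.ne
      have := db.ne
      have := dc.ne
      have := ea.ne
      have := eb.ne
      have := ec.ne
      rintro (i | i) (j | j) hij <;> fin_cases i <;> fin_cases j <;> simp_all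
    · have key : ∀ (i : Fin 2) (j : Fin 3), G.Adj (![d, e] i) (![a, b, c] j) := by
        intro i j
        fin_cases i <;> fin_cases j <;> assumption
      rintro (i | i) (j | j) hij
      · simp at hij
      · exact key i j
      · exact (key j i).symm
      · simp at hij
  obtain ⟨p, hp, b, hb, hpx, hpy, hbx, hby, hpb⟩ := two_triples (G.neighborFinset d)
    (G.neighborFinset e) (by rw [G.card_neighborFinset_eq_degree, hd])
    (by rw [G.card_neighborFinset_eq_degree, he]) hne x y (by simpa using hx) (by simpa using hy) hxy
  rw [SimpleGraph.mem_neighborFinset] at hp hb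
  have star : ∀ d x p, G.degree d = 3 → G.Adj d x → G.Adj d p → p ≠ x →
      SafeSet G ({d, x, p} : Set V) := by
    intro d x p hd hx hp hpx v hv a b ha hb haS hbS
    simp only [Set.mem_insert_iff, Set.mem_singleton_iff, not_or] at hv haS hbS
    rcases hv with rfl | rfl | rfl
    · have := hu3 v a b x p ha hb hx hp
      grind
    · have := hu2 v a b d (fun h => hind _ _ hd h hx) ha hb hx.symm
      grind
    · have := hu2 v a b d (fun h => hind _ _ hd h hp) ha hb hp.symm
      grind
  refine exists_cut_of_disjoint_safe G hu3 {d, x, p} {e, y, b} (star d x p hd hx hp hpx)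
    (star e y b he hy hb hby) ?_ x' y' (by simp; tauto) (by simp; tauto)
  have k1 : d ≠ y := by rintro rfl; exact hind _ _ he hd hy
  have k2 : d ≠ b := by rintro rfl; exact hind _ _ he hd hb
  have k3 : x ≠ e := by rintro rfl; exact hind _ _ hd he hx
  have k4 : p ≠ e := by rintro rfl; exact hind _ _ hd he hp
  intro v hv hv'
  simp only [Set.mem_insert_iff, Set.mem_singleton_iff] at hv hv'
  grind

theorem IsMatchingSepCut.swap {V : Type*} {G : SimpleGraph V} {F : Set (Sym2 V)} {x y : V}
    (h : IsMatchingSepCut G F x y) : IsMatchingSepCut G F y x :=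
  ⟨⟨h.1.1, fun k => h.1.2 k.symm⟩, h.2⟩

/-- Either a trivial cut around `x` works, or `x` has degree 3, or it has degree 2 and all its
neighbours other than `y` have degree 3. -/
theorem cut_or_center {V : Type*} [Fintype V] (G : SimpleGraph V) [DecidableRel G.Adj]
    (hu2 : ∀ v a b c, G.degree v ≠ 3 → G.Adj v a → G.Adj v b → G.Adj v c →
      a = b ∨ a = c ∨ b = c)
    (htri : ¬ HasTriangle G) (x y : V) (hxy : x ≠ y) :
    (∃ F, IsMatchingSepCut G F x y) ∨ G.degree x = 3 ∨
      ((∃ a b, a ≠ b ∧ G.Adj x a ∧ G.Adj x b) ∧ ∀ a, G.Adj x a → a ≠ y → G.degree a = 3) := by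
  by_cases h3 : G.degree x = 3
  · exact Or.inr (Or.inl h3)
  by_cases h2 : ∃ a b, a ≠ b ∧ G.Adj x a ∧ G.Adj x b
  · by_cases h : ∀ a, G.Adj x a → a ≠ y → G.degree a = 3
    · exact Or.inr (Or.inr ⟨h2, h⟩)
    left
    push Not at h
    obtain ⟨e, hxe, hey, he⟩ := h
    refine matchingCut_of_safe G {x, e} x y (by simp) (by simp [hxy.symm, hey.symm]) ?_ ?_
    · intro v hv a b ha hb haS hbS
      simp only [Set.mem_insert_iff, Set.mem_singleton_iff, not_or] at hv haS hbS
      rcases hv with rfl | rfl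
      · have := hu2 v a b e h3 ha hb hxe
        grind
      · have := hu2 v a b x he ha hb hxe.symm
        grind
    · intro v hv a b ha hb haS hbS
      simp only [Set.mem_compl_iff, not_not, Set.mem_insert_iff, Set.mem_singleton_iff] at haS hbS
      rcases haS with rfl | rfl <;> rcases hbS with rfl | rfl
      · rfl
      · exact (htri ⟨v, a, b, ha, hxe, hb⟩).elim
      · exact (htri ⟨v, b, a, hb, hxe, ha⟩).elim
      · rfl
  · left
    push Not at h2
    refine matchingCut_of_safe G {x} x y (by simp) (by simp [hxy.symm]) ?_ ?_
    · intro v hv a b ha hb _ _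
      obtain rfl : v = x := hv
      by_contra hab
      exact h2 a b hab ha hb
    · intro v hv a b ha hb haS hbS
      simp only [Set.mem_compl_iff, not_not, Set.mem_singleton_iff] at haS hbS
      rw [haS, hbS]

theorem stmt12 {V : Type*} [Fintype V] (G : SimpleGraph V) [DecidableRel G.Adj]
    (hconn : G.Connected) (hdeg : G.maxDegree = 3)
    (hind : ∀ v w : V, G.degree v = 3 → G.degree w = 3 → ¬ G.Adj v w)
    (htri : ¬ HasTriangle G) (hK23 : ¬ HasK23 G) :
    ∀ x y : V, x ≠ y → ∃ F, IsMatchingSepCut G F x y := by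
  classical
  have h3 : ∀ v, G.degree v ≤ 3 := fun v => hdeg ▸ G.degree_le_maxDegree v
  have hu3 : ∀ v a b c d, G.Adj v a → G.Adj v b → G.Adj v c → G.Adj v d →
      a = b ∨ a = c ∨ a = d ∨ b = c ∨ b = d ∨ c = d := by
    intro v a b c d ha hb hc hd
    by_contra hcon
    push Not at hcon
    have hsub : ({a, b, c, d} : Finset V) ⊆ G.neighborFinset v := by
      intro z hz
      simp only [Finset.mem_insert, Finset.mem_singleton] at hz
      rw [SimpleGraph.mem_neighborFinset]
      rcases hz with rfl | rfl | rfl | rfl <;> assumption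
    have hc := Finset.card_le_card hsub
    rw [G.card_neighborFinset_eq_degree] at hc
    have : ({a, b, c, d} : Finset V).card = 4 := by grind
    have := h3 v
    omega
  have hu2 : ∀ v a b c, G.degree v ≠ 3 → G.Adj v a → G.Adj v b → G.Adj v c →
      a = b ∨ a = c ∨ b = c := by
    intro v a b c hv ha hb hc
    by_contra hcon
    push Not at hcon
    have hsub : ({a, b, c} : Finset V) ⊆ G.neighborFinset v := by
      intro z hz
      simp only [Finset.mem_insert, Finset.mem_singleton] at hz
      rw [SimpleGraph.mem_neighborFinset]
      rcases hz with rfl | rfl | rfl <;> assumption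
    have hc := Finset.card_le_card hsub
    rw [G.card_neighborFinset_eq_degree] at hc
    have : ({a, b, c} : Finset V).card = 3 := Finset.card_eq_three.2 ⟨a, b, c, hcon.1, hcon.2.1, hcon.2.2, rfl⟩
    have := h3 v
    omega
  have hnb : ∀ v z, G.degree v = 3 → ∃ a, G.Adj v a ∧ a ≠ z := by
    intro v z hv
    have : 1 < (G.neighborFinset v).card := by rw [G.card_neighborFinset_eq_degree, hv]; norm_num
    obtain ⟨a, ha, hne⟩ := Finset.exists_mem_ne this z
    exact ⟨a, by simpa using ha, hne⟩
  intro x y hxy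
  rcases cut_or_center G hu2 htri x y hxy with h | hx
  · exact h
  rcases cut_or_center G hu2 htri y x hxy.symm with ⟨F, hF⟩ | hy
  · exact ⟨F, hF.swap⟩
  have main := cut_of_centers G h3 hu3 hu2 hind hK23
  have pick : ∀ x y, ((∃ a b, a ≠ b ∧ G.Adj x a ∧ G.Adj x b) ∧
      ∀ a, G.Adj x a → a ≠ y → G.degree a = 3) → ∃ d, d ≠ y ∧ G.Adj x d ∧ G.degree d = 3 := by
    rintro x y ⟨⟨a, b, hab, ha, hb⟩, h⟩
    by_cases hay : a = y
    · exact ⟨b, fun hb' => hab (hay.trans hb'.symm), hb, h b hb (fun hb' => hab (hay.trans hb'.symm))⟩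
    · exact ⟨a, hay, ha, h a ha hay⟩
  rcases hx with hx | hx <;> rcases hy with hy | hy
  · obtain ⟨a, ha, -⟩ := hnb x x hx
    obtain ⟨b, hb, hne⟩ := hnb y a hy
    exact main x y a b hx hy hxy ha hb hne.symm x y (Or.inl rfl) (Or.inl rfl)
  · obtain ⟨e, hex, hye, he⟩ := pick y x hy
    obtain ⟨a, ha, hne⟩ := hnb x y hx
    exact main x e a y hx he hex.symm ha hye.symm hne x y (Or.inl rfl) (Or.inr rfl)
  · obtain ⟨d, hdy, hxd, hd⟩ := pick x y hx
    obtain ⟨b, hb, hne⟩ := hnb y x hy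
    exact main d y x b hd hy hdy hxd.symm hb hne.symm x y (Or.inr rfl) (Or.inl rfl)
  · obtain ⟨d, hdy, hxd, hd⟩ := pick x y hx
    suffices h : ∃ e, e ≠ d ∧ G.Adj y e ∧ G.degree e = 3 by
      obtain ⟨e, hed, hye, he⟩ := h
      exact main d e x y hd he hed.symm hxd.symm hye.symm hxy x y (Or.inr rfl) (Or.inr rfl)
    by_cases hadj : G.Adj x y
    · obtain ⟨e, hex, hye, he⟩ := pick y x hy
      refine ⟨e, ?_, hye, he⟩
      rintro rfl
      exact htri ⟨x, y, e, hadj, hye, hxd⟩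
    · obtain ⟨⟨a, b, hab, ha, hb⟩, h⟩ := hy
      have hax : a ≠ x := by rintro rfl; exact hadj ha.symm
      have hbx : b ≠ x := by rintro rfl; exact hadj hb.symm
      by_cases had : a = d
      · exact ⟨b, fun k => hab (had.trans k.symm), hb, h b hb hbx⟩
      · exact ⟨a, had, ha, h a ha hax⟩
end
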